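/- Suppose d' = d and d is even. Then, as (α,β,γ) ranges over F_{p^m} × F_q × F_q, the value S(α,β,γ) equals: p^m for exactly p^{m+d−1}(p^m+1)(p^m+p−1)(p^n−1)/(2(p^d+1)) triples; −p^m for exactly p^{m+d−1}(p^m−1)(p^m−p+1)(p^n−2p^{n−d}+1)/(2(p^d−1)) triples; for each j with 1 ≤ j ≤ p−1: ζ_p^j·p^m for exactly p^{m+d−1}(p^n−1)^2/(2(p^d+1)) triples, and −ζ_p^j·p^m for exactly p^{m+d−1}(p^n−1)(p^n−2p^{n−d}+1)/(2(p^d−1)) triples; for each ε ∈ {1,−1}: ε·p^{m+d/2} for exactly (1/2)p^{n−3d/2−1}(p^{m−d/2}+ε(p−1))(p^n−1) triples, and for each j with 1 ≤ j ≤ p−1, ε·ζ_p^j·p^{m+d/2} for exactly (1/2)p^{n−3d/2−1}(p^{m−d/2}−ε)(p^n−1) triples; −p^{m+d} for exactly p^{m−d−1}(p^{m−d}−1)(p^n−1)(p^{m−d}−p+1)/(p^{2d}−1) triples; for each j with 1 ≤ j ≤ p−1, −ζ_p^j·p^{m+d} for exactly p^{m−d−1}(p^{m−d}−1)(p^n−1)(p^{m−d}+1)/(p^{2d}−1)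 triples; 0 for exactly (p^n−1)(p^{3m−d}−p^{3m−2d}+p^{3m−3d}−p^{n−2d}+1) triples; and p^n for exactly 1 triple; S takes no other values. -/

import Mathlib

open scoped BigOperators Classical

noncomputable section

/-- The map `φ_{α,β}(x) = α x^{p^m} + β x^{p^k} + β^{p^{n-k}} x^{p^{n-k}}`. -/
def phiMap (p m n k : ℕ) {F : Type} [Field F] (α β x : F) : F :=
  α * x ^ p ^ m + β * x ^ p ^ k + β ^ p ^ (n - k) * x ^ p ^ (n - k)

/-- The trace-type sum `x ↦ ∑_{i<r} x^{p^{t i}}`; for `x` in the subfield of size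
`p^{t·r}` this is the relative trace down to the subfield of size `p^t`. -/
def trSum (p t r : ℕ) {F : Type} [Field F] (x : F) : F :=
  ∑ i ∈ Finset.range r, x ^ p ^ (t * i)

/-- `ζ_p^c = exp(2πi·c̃/p)` for a lift `c̃` of `c : F_p`. -/
noncomputable def expChar (p : ℕ) (c : ZMod p) : ℂ :=
  Complex.exp (2 * Real.pi * Complex.I * (c.val : ℂ) / (p : ℂ))

/-- Identify an element of the prime field of `F` with an element of `ZMod p`
(the partial inverse of the algebra map). -/
noncomputable def fToZMod (p : ℕ) {F : Type} [Field F] [Algebra (ZMod p) F] (x : F) : ZMod p :=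
  letI : Nonempty (ZMod p) := ⟨0⟩
  Function.invFun (algebraMap (ZMod p) F) x

/-- `T(α,β) = ∑_{x ∈ F_q} ζ_p^{Tr^m_1(α x^{p^m+1}) + Tr^n_1(β x^{p^k+1})}`. -/
noncomputable def Tsum (p m n k : ℕ) (F : Type) [Field F] [Fintype F] [Algebra (ZMod p) F]
    (α β : F) : ℂ :=
  ∑ x : F, expChar p (fToZMod p (trSum p 1 m (α * x ^ (p ^ m + 1))) +
      fToZMod p (trSum p 1 n (β * x ^ (p ^ k + 1))))

/-- `S(α,β,γ) = ∑_{x ∈ F_q} ζ_p^{Tr^m_1(α x^{p^m+1}) + Tr^n_1(β x^{p^k+1} + γ x)}`. -/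
noncomputable def Ssum (p m n k : ℕ) (F : Type) [Field F] [Fintype F] [Algebra (ZMod p) F]
    (α β γ : F) : ℂ :=
  ∑ x : F, expChar p (fToZMod p (trSum p 1 m (α * x ^ (p ^ m + 1))) +
      fToZMod p (trSum p 1 n (β * x ^ (p ^ k + 1) + γ * x)))

/-- `√(q₀*)` where `q₀* = (−1)^{(q₀−1)/2} q₀`. -/
noncomputable def sqrtStar (q0 : ℕ) : ℂ :=
  if q0 % 4 = 1 then (Real.sqrt q0 : ℂ) else Complex.I * (Real.sqrt q0 : ℂ)

/-- `ζ_p = exp(2πi/p)`. -/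
noncomputable def zetaC (p : ℕ) : ℂ := Complex.exp (2 * Real.pi * Complex.I / (p : ℂ))

/-- Number of pairs `(α,β) ∈ F_{p^m} × F_q` with `T(α,β) = v`. -/
noncomputable def Tcount (p m n k : ℕ) (F : Type) [Field F] [Fintype F] [Algebra (ZMod p) F]
    (v : ℂ) : ℕ :=
  Nat.card {ab : F × F // ab.1 ^ p ^ m = ab.1 ∧ Tsum p m n k F ab.1 ab.2 = v}

/-- Number of triples `(α,β,γ) ∈ F_{p^m} × F_q × F_q` with `S(α,β,γ) = v`. -/
noncomputable def Scount (p m n k : ℕ) (F : Type) [Field F] [Fintype F] [Algebra (ZMod p) F]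
    (v : ℂ) : ℕ :=
  Nat.card {abc : F × F × F // abc.1 ^ p ^ m = abc.1 ∧ Ssum p m n k F abc.1 abc.2.1 abc.2.2 = v}

/-- Hamming weight of the codeword of `C₁` attached to `(α,β)`:
the number of `0 ≤ i ≤ q-2` with `Tr^m_t(α π^{i(p^m+1)}) + Tr^n_t(β π^{i(p^k+1)}) ≠ 0`. -/
noncomputable def wt1 (p m n k t : ℕ) {F : Type} [Field F] (π α β : F) : ℕ :=
  Nat.card {i : ℕ // i ≤ p ^ n - 2 ∧
    trSum p t (m / t) (α * π ^ (i * (p ^ m + 1))) +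
    trSum p t (n / t) (β * π ^ (i * (p ^ k + 1))) ≠ 0}

/-- Number of pairs `(α,β) ∈ F_{p^m} × F_q` whose `C₁`-codeword has weight `v`. -/
noncomputable def wt1count (p m n k t : ℕ) (F : Type) [Field F] [Fintype F] (π : F) (v : ℕ) : ℕ :=
  Nat.card {ab : F × F // ab.1 ^ p ^ m = ab.1 ∧ wt1 p m n k t π ab.1 ab.2 = v}

/-- Hamming weight of the codeword of `C₂` attached to `(α,β,γ)`. -/
noncomputable def wt2 (p m n k t : ℕ) {F : Type} [Field F] (π α β γ : F) : ℕ :=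
  Nat.card {i : ℕ // i ≤ p ^ n - 2 ∧
    trSum p t (m / t) (α * π ^ (i * (p ^ m + 1))) +
    trSum p t (n / t) (β * π ^ (i * (p ^ k + 1)) + γ * π ^ i) ≠ 0}

/-- Number of triples `(α,β,γ)` whose `C₂`-codeword has weight `v`. -/
noncomputable def wt2count (p m n k t : ℕ) (F : Type) [Field F] [Fintype F] (π : F) (v : ℕ) : ℕ :=
  Nat.card {abc : F × F × F // abc.1 ^ p ^ m = abc.1 ∧ wt2 p m n k t π abc.1 abc.2.1 abc.2.2 = v}

set_option linter.unusedSectionVars false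

section Frobenius

lemma pow_pow_eq_iterate {F : Type} [Field F] {p : ℕ} (j : ℕ) (x : F) :
    x ^ p ^ j = (fun y : F => y ^ p)^[j] x := by
  induction j with
  | zero => simp
  | succ j ih => rw [Function.iterate_succ_apply', ← ih, pow_succ, pow_mul]

lemma pow_gcd_fixed {F : Type} [Field F] {p i j : ℕ} {x : F} (hi : x ^ p ^ i = x) (hj : x ^ p ^ j = x) :
    x ^ p ^ (i.gcd j) = x := by
  rw [pow_pow_eq_iterate] at *
  exact Function.IsPeriodicPt.gcd hi hj

lemma pow_fixed_of_dvd {F : Type} [Field F] {p i j : ℕ} {x : F} (hi : x ^ p ^ i = x) (hij : i ∣ j) :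
    x ^ p ^ j = x := by
  rw [pow_pow_eq_iterate] at *
  exact Function.IsPeriodicPt.trans_dvd hi hij

variable (F : Type) [Field F] (p : ℕ) [Fact p.Prime] [CharP F p]

/-- The subfield of elements fixed by the `p^j`-power map. -/
def frobFixed (j : ℕ) : Subfield F :=
  (iterateFrobenius F p j).eqLocusField (RingHom.id F)

variable {F p}

lemma mem_frobFixed {j : ℕ} {x : F} : x ∈ frobFixed F p j ↔ x ^ p ^ j = x := by
  simp [frobFixed, RingHom.mem_eqLocusField, iterateFrobenius_def]

lemma card_frobFixed [Fintype F] {n : ℕ} (hF : Fintype.card F = p ^ n) (j : ℕ) :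
    Fintype.card (frobFixed F p j) = p ^ n.gcd j := by
  have hp : p.Prime := Fact.out
  have hpos : ∀ i, 1 ≤ p ^ i := fun i => Nat.one_le_pow _ _ hp.pos
  have hker := IsCyclic.card_powMonoidHom_ker Fˣ (p ^ j - 1)
  rw [Nat.card_units, Nat.card_eq_fintype_card (α := F), hF, Nat.pow_sub_one_gcd_pow_sub_one] at hker
  have e : (frobFixed F p j)ˣ ≃ (powMonoidHom (p ^ j - 1) : Fˣ →* Fˣ).ker := by
    refine Equiv.ofBijective
      (fun u => ⟨Units.map (frobFixed F p j).subtype.toMonoidHom u, ?_⟩) ⟨?_, ?_⟩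
    · rw [MonoidHom.mem_ker]
      ext
      have hu := mem_frobFixed.1 (u : frobFixed F p j).2
      have h0 : ((u : frobFixed F p j) : F) ≠ 0 := by simp
      simp only [powMonoidHom_apply, Units.val_pow_eq_pow_val, Units.val_one]
      apply mul_right_cancel₀ h0
      rw [one_mul]
      change ((u : frobFixed F p j) : F) ^ (p ^ j - 1) * _ = _
      rw [← pow_succ, Nat.sub_add_cancel (hpos j), hu]
    · intro u v huv
      ext
      have := congrArg (fun w : (powMonoidHom (p ^ j - 1) : Fˣ →* Fˣ).ker => ((w : Fˣ) : F)) huv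
      simpa using this
    · rintro ⟨v, hv⟩
      rw [MonoidHom.mem_ker] at hv
      have hv' : (v : F) ^ p ^ j = v := by
        have := congrArg (fun w : Fˣ => (w : F)) hv
        simp only [powMonoidHom_apply, Units.val_pow_eq_pow_val, Units.val_one] at this
        rw [← Nat.sub_add_cancel (hpos j), pow_succ, this, one_mul]
      refine ⟨Units.mk0 ⟨v, mem_frobFixed.2 hv'⟩ ?_, ?_⟩
      · intro h0
        exact v.ne_zero (congrArg Subtype.val h0)
      · ext
        simp
  have h1 := Nat.card_congr e
  rw [hker, Nat.card_units, Nat.card_eq_fintype_card] at h1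
  have h2 : 1 ≤ Fintype.card (frobFixed F p j) := Fintype.card_pos
  have := hpos (n.gcd j)
  omega

end Frobenius

section CharacterSums

lemma addChar_apply_ne_zero {A : Type} [AddGroup A] (ψ : AddChar A ℂ) (x : A) : ψ x ≠ 0 := by
  intro hx
  have := AddChar.map_add_eq_mul ψ x (-x)
  simp [hx] at this

/-- Orthogonality of an additive character restricted to a finite field. -/
lemma sum_mul_addChar {K : Type} [Field K] [Fintype K] {χ : AddChar K ℂ} (hχ : χ ≠ 1) (y : K) :
    ∑ c, χ (c * y) = if y = 0 then (Fintype.card K : ℂ) else 0 := by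
  have := AddChar.sum_mulShift y (AddChar.IsPrimitive.of_ne_one hχ)
  rw [this]
  split_ifs <;> simp

/-- A quadratic Gauss sum squares to the size of the field when `-1` is a square. -/
lemma sq_sum_addChar_sq {K : Type} [Field K] [Fintype K] {χ : AddChar K ℂ} (hχ : χ ≠ 1)
    (h2 : (2 : K) ≠ 0) {ι : K} (hι : ι ^ 2 = -1) :
    (∑ c, χ (c ^ 2)) ^ 2 = Fintype.card K := by
  have hι0 : ι ≠ 0 := by
    rintro rfl
    simp at hι
  rw [sq, Finset.sum_mul_sum, Finset.sum_comm]
  have h1 : ∀ y : K, ∑ x, χ (x ^ 2) * χ (y ^ 2) = ∑ z, χ (z ^ 2) * χ (y * (2 * ι * z)) := by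
    intro y
    refine Fintype.sum_equiv (Equiv.subRight (ι * y)) _ _ fun x => ?_
    rw [← AddChar.map_add_eq_mul, ← AddChar.map_add_eq_mul]
    congr 1
    simp only [Equiv.subRight_apply]
    linear_combination y ^ 2 * hι
  rw [Finset.sum_congr rfl fun y _ => h1 y, Finset.sum_comm]
  simp_rw [← Finset.mul_sum, sum_mul_addChar hχ]
  simp [hι0, h2]

end CharacterSums

section QuadraticForms

variable {F : Type} [Field F]

/-- The `F`-valued polynomial whose trace is the quadratic form
`Tr^m_1(α x^{p^m+1}) + Tr^n_1(β x^{p^k+1})` when `α` lies in the subfield of size `p^m`. -/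
def quadVal (p m k : ℕ) (α β x : F) : F :=
  α * x ^ (p ^ m + 1) / 2 + β * x ^ (p ^ k + 1)

/-- The exponential sum of `quadVal` with linear term `γ x`. -/
def quadSum [Fintype F] (ψ : AddChar F ℂ) (p m k : ℕ) (α β γ : F) : ℂ :=
  ∑ x, ψ (quadVal p m k α β x + γ * x)

/-- Number of zeros of `φ_{α,β}`. -/
def kerCard [Fintype F] (p m n k : ℕ) (α β : F) : ℕ :=
  (Finset.univ.filter fun x => phiMap p m n k α β x = 0).card

/-- The standing assumptions on the parameters and on the canonical additive character. -/
structure IsFormSetup (p m n k d : ℕ) [Fintype F] (ψ : AddChar F ℂ) : Prop where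
  odd : p % 2 = 1
  pos : 0 < m
  n_eq : n = 2 * m
  le : k ≤ n
  gcd_left : m.gcd k = d
  gcd_add : n.gcd (m + k) = d
  even : d % 2 = 0
  card : Fintype.card F = p ^ n
  ne_one : ψ ≠ 1
  frob : ∀ x, ψ (x ^ p) = ψ x

lemma quadVal_mul (p m k : ℕ) (α β v x : F) :
    quadVal p m k α β (v * x) =
      quadVal p m k (α * v ^ (p ^ m + 1)) (β * v ^ (p ^ k + 1)) x := by
  simp only [quadVal, mul_pow]
  ring

lemma quadSum_scale [Fintype F] (ψ : AddChar F ℂ) (p m k : ℕ) (α β : F) {v : F} (hv : v ≠ 0) :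
    quadSum ψ p m k (α * v ^ (p ^ m + 1)) (β * v ^ (p ^ k + 1)) 0 =
      quadSum ψ p m k α β 0 := by
  refine Fintype.sum_equiv (Equiv.mulLeft₀ v hv) _ _ fun x => ?_
  simp [quadVal_mul]

namespace IsFormSetup

variable [Fintype F] {p m n k d : ℕ} [hp : Fact p.Prime] [CharP F p] {ψ : AddChar F ℂ}

lemma pow_n (h : IsFormSetup p m n k d ψ) (x : F) : x ^ p ^ n = x := by
  rw [← h.card, FiniteField.pow_card]

lemma pow_m_m (h : IsFormSetup p m n k d ψ) (x : F) : (x ^ p ^ m) ^ p ^ m = x := by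
  rw [← pow_mul, ← pow_add, ← Nat.two_mul, ← h.n_eq, h.pow_n]

lemma pow_k_sub (h : IsFormSetup p m n k d ψ) (x : F) : (x ^ p ^ k) ^ p ^ (n - k) = x := by
  rw [← pow_mul, ← pow_add, Nat.add_sub_cancel' h.le, h.pow_n]

lemma pow_sub_k (h : IsFormSetup p m n k d ψ) (x : F) : (x ^ p ^ (n - k)) ^ p ^ k = x := by
  rw [← pow_mul, mul_comm, pow_mul, h.pow_k_sub]

lemma map_pow (h : IsFormSetup p m n k d ψ) (j : ℕ) (x : F) : ψ (x ^ p ^ j) = ψ x := by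
  induction j with
  | zero => simp
  | succ j ih => rw [pow_succ, pow_mul, h.frob, ih]

lemma two_ne_zero (h : IsFormSetup p m n k d ψ) : (2 : F) ≠ 0 := by
  refine Ring.two_ne_zero ?_
  rw [ringChar.eq F p]
  rintro rfl
  exact absurd h.odd (by norm_num)

lemma two_pow (j : ℕ) : (2 : F) ^ p ^ j = 2 := by
  have := map_ofNat (iterateFrobenius F p j) 2
  rwa [iterateFrobenius_def] at this

lemma sum_mul (h : IsFormSetup p m n k d ψ) (a : F) :
    ∑ y, ψ (a * y) = if a = 0 then (p : ℂ) ^ n else 0 := by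
  simp_rw [mul_comm a]
  rw [sum_mul_addChar h.ne_one, h.card]
  push_cast
  rfl

lemma map_pow_p (x : F) : ψ x ^ p = 1 := by
  rw [← AddChar.map_nsmul_eq_pow, nsmul_eq_mul, CharP.cast_eq_zero, zero_mul,
    AddChar.map_zero_eq_one]

lemma even_add_one (h : IsFormSetup p m n k d ψ) (j : ℕ) : Even (p ^ j + 1) :=
  ((Nat.odd_iff.2 h.odd).pow).add_odd odd_one

lemma quadVal_neg (h : IsFormSetup p m n k d ψ) (α β x : F) :
    quadVal p m k α β (-x) = quadVal p m k α β x := by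
  simp only [quadVal, (h.even_add_one _).neg_pow]

lemma quadVal_zero (α β : F) : quadVal p m k α β 0 = 0 := by
  simp [quadVal]

lemma phiMap_add (α β x y : F) :
    phiMap p m n k α β (x + y) = phiMap p m n k α β x + phiMap p m n k α β y := by
  simp only [phiMap, add_pow_char_pow]
  ring

lemma phiMap_zero (α β : F) : phiMap p m n k α β 0 = 0 := by
  simp [phiMap, hp.out.ne_zero]

lemma phiMap_neg (α β x : F) : phiMap p m n k α β (-x) = -phiMap p m n k α β x := by
  rw [eq_neg_iff_add_eq_zero, ← phiMap_add, neg_add_cancel, phiMap_zero]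

/-- Polarization: `φ_{α,β}` represents the polar form of the quadratic form. -/
lemma map_quadVal_add (h : IsFormSetup p m n k d ψ) {α : F} (hα : α ^ p ^ m = α) (β x y : F) :
    ψ (quadVal p m k α β (x + y)) =
      ψ (quadVal p m k α β x) * ψ (quadVal p m k α β y) * ψ (phiMap p m n k α β x * y) := by
  have e : quadVal p m k α β (x + y) = quadVal p m k α β x + quadVal p m k α β y
      + (α * x * y ^ p ^ m / 2 + α * x ^ p ^ m * y / 2 + β * x ^ p ^ k * y
        + β * x * y ^ p ^ k) := by
    simp only [quadVal, pow_succ, add_pow_char_pow]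
    ring
  have e1 : ψ (α * x * y ^ p ^ m / 2) = ψ (α * x ^ p ^ m * y / 2) := by
    rw [← h.map_pow m, div_pow, mul_pow, mul_pow, hα, h.pow_m_m, two_pow]
  have e2 : ψ (β * x * y ^ p ^ k) = ψ (β ^ p ^ (n - k) * x ^ p ^ (n - k) * y) := by
    rw [← h.map_pow (n - k), mul_pow, mul_pow, h.pow_k_sub]
  have e3 : phiMap p m n k α β x * y = α * x ^ p ^ m * y / 2 + α * x ^ p ^ m * y / 2
      + β * x ^ p ^ k * y + β ^ p ^ (n - k) * x ^ p ^ (n - k) * y := by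
    have := h.two_ne_zero
    simp only [phiMap]
    field_simp
    ring
  rw [e, e3]
  simp only [AddChar.map_add_eq_mul, e1, e2]

lemma map_phiMap_comm (h : IsFormSetup p m n k d ψ) {α : F} (hα : α ^ p ^ m = α) (β x y : F) :
    ψ (phiMap p m n k α β x * y) = ψ (phiMap p m n k α β y * x) := by
  have h1 := h.map_quadVal_add hα β x y
  rw [add_comm x y, h.map_quadVal_add hα β y x, mul_comm (ψ (quadVal p m k α β y))] at h1
  exact (mul_left_cancel₀ (mul_ne_zero (addChar_apply_ne_zero ψ _) (addChar_apply_ne_zero ψ _)) h1).symm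

/-- The quadratic form vanishes on the radical. -/
lemma map_quadVal_of_phiMap (h : IsFormSetup p m n k d ψ) {α : F} (hα : α ^ p ^ m = α) {β z : F}
    (hz : phiMap p m n k α β z = 0) : ψ (quadVal p m k α β z) = 1 := by
  have h1 := h.map_quadVal_add hα β z (-z)
  rw [add_neg_cancel, quadVal_zero, h.quadVal_neg, hz, zero_mul, AddChar.map_zero_eq_one,
    mul_one, ← sq] at h1
  have h2 := map_pow_p (p := p) (ψ := ψ) (quadVal p m k α β z)
  obtain ⟨r, hr⟩ := Nat.odd_iff.2 h.odd
  nth_rw 2 [hr] at h2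
  rw [pow_add, pow_mul, ← h1, one_pow, one_mul, pow_one] at h2
  exact h2

/-- The number of preimages under `φ_{α,β}` as a character sum over the kernel. -/
lemma card_fiber (h : IsFormSetup p m n k d ψ) {α : F} (hα : α ^ p ^ m = α) (β γ : F) :
    ((Finset.univ.filter fun x => phiMap p m n k α β x = γ).card : ℂ) =
      ∑ w ∈ Finset.univ.filter (fun w => phiMap p m n k α β w = 0), ψ (γ * w) := by
  have hpn : (p : ℂ) ^ n ≠ 0 := pow_ne_zero _ (Nat.cast_ne_zero.2 hp.out.ne_zero)
  apply mul_left_cancel₀ hpn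
  have h1 : ∑ x, ∑ w, ψ ((γ - phiMap p m n k α β x) * w) =
      (p : ℂ) ^ n * ((Finset.univ.filter fun x => phiMap p m n k α β x = γ).card : ℂ) := by
    simp_rw [h.sum_mul, sub_eq_zero, eq_comm (a := γ)]
    rw [← Finset.sum_filter, Finset.sum_const, nsmul_eq_mul, mul_comm]
  rw [← h1, Finset.sum_comm, Finset.mul_sum, Finset.sum_filter]
  refine Finset.sum_congr rfl fun w _ => ?_
  have h2 : ∀ x, ψ ((γ - phiMap p m n k α β x) * w) =
      ψ (γ * w) * ψ (phiMap p m n k α β w * -x) := by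
    intro x
    rw [sub_mul, sub_eq_add_neg, AddChar.map_add_eq_mul, ← neg_mul, ← phiMap_neg,
      h.map_phiMap_comm hα]
  simp_rw [h2]
  rw [← Finset.mul_sum, Fintype.sum_equiv (Equiv.neg F) _
    (fun x => ψ (phiMap p m n k α β w * x)) (fun x => by simp), h.sum_mul]
  split_ifs <;> ring

lemma quadSum_mul_neg (h : IsFormSetup p m n k d ψ) {α : F} (hα : α ^ p ^ m = α) (β γ : F) :
    quadSum ψ p m k α β γ * (∑ y, ψ (-(quadVal p m k α β y + γ * y))) =
      (p : ℂ) ^ n * (Finset.univ.filter fun x => phiMap p m n k α β x = γ).card := by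
  rw [h.card_fiber hα, quadSum, Finset.sum_mul_sum, Finset.sum_comm, Finset.mul_sum,
    Finset.sum_filter]
  have h1 : ∀ y, ∑ x, ψ (quadVal p m k α β x + γ * x) * ψ (-(quadVal p m k α β y + γ * y)) =
      ∑ z, ψ (quadVal p m k α β z) * ψ (γ * z) * ψ (phiMap p m n k α β z * y) := by
    intro y
    refine Fintype.sum_equiv (Equiv.subRight y) _ _ fun x => ?_
    obtain ⟨z, rfl⟩ : ∃ z, x = z + y := ⟨x - y, by ring⟩
    have e : γ * (z + y) + -(quadVal p m k α β y + γ * y) = γ * z - quadVal p m k α β y := by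
      ring
    rw [← AddChar.map_add_eq_mul, add_assoc, e, AddChar.map_add_eq_mul, h.map_quadVal_add hα,
      AddChar.map_sub_eq_div, Equiv.subRight_apply, add_sub_cancel_right]
    have := addChar_apply_ne_zero ψ (quadVal p m k α β y)
    field_simp
  rw [Finset.sum_congr rfl fun y _ => h1 y, Finset.sum_comm]
  refine Finset.sum_congr rfl fun z _ => ?_
  rw [← Finset.mul_sum, h.sum_mul]
  split_ifs with hz
  · rw [h.map_quadVal_of_phiMap hα hz]
    ring
  · ring

lemma quadSum_phiMap (h : IsFormSetup p m n k d ψ) {α : F} (hα : α ^ p ^ m = α) (β x : F) :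
    quadSum ψ p m k α β (phiMap p m n k α β x) =
      ψ (-quadVal p m k α β x) * quadSum ψ p m k α β 0 := by
  rw [quadSum, quadSum, Finset.mul_sum]
  refine Fintype.sum_equiv (Equiv.addLeft x) _ _ fun y => ?_
  rw [Equiv.coe_addLeft, zero_mul, add_zero, h.map_quadVal_add hα, AddChar.map_add_eq_mul,
    AddChar.map_neg_eq_inv]
  have := addChar_apply_ne_zero ψ (quadVal p m k α β x)
  field_simp

/-- If `γ` is not in the image of `φ_{α,β}` then the sum vanishes. -/
lemma exists_phiMap_eq (h : IsFormSetup p m n k d ψ) {α : F} (hα : α ^ p ^ m = α) {β γ : F}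
    (hS : quadSum ψ p m k α β γ ≠ 0) : ∃ x, phiMap p m n k α β x = γ := by
  by_contra! hne
  have h1 := h.quadSum_mul_neg hα β γ
  rw [Finset.filter_false_of_mem fun x _ => hne x] at h1
  have h2 : ∑ y, ψ (-(quadVal p m k α β y + γ * y)) =
      (starRingEnd ℂ) (quadSum ψ p m k α β γ) := by
    rw [quadSum, map_sum]
    exact Finset.sum_congr rfl fun y _ => AddChar.map_neg_eq_conj ψ _
  rw [h2] at h1
  simp [hS] at h1

end IsFormSetup

end QuadraticForms

namespace IsFormSetup

variable {F : Type} [Field F] [Fintype F] {p m n k d : ℕ} [hp : Fact p.Prime] [CharP F p]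
  {ψ : AddChar F ℂ}

lemma dvd_left (h : IsFormSetup p m n k d ψ) : d ∣ m := h.gcd_left ▸ Nat.gcd_dvd_left m k

lemma dvd_right (h : IsFormSetup p m n k d ψ) : d ∣ k := h.gcd_left ▸ Nat.gcd_dvd_right m k

lemma two_dvd (h : IsFormSetup p m n k d ψ) : 2 ∣ d := Nat.dvd_of_mod_eq_zero h.even

lemma d_pos (h : IsFormSetup p m n k d ψ) : 0 < d :=
  h.gcd_left ▸ Nat.gcd_pos_of_pos_left k h.pos

/-- Elements of the prime field have square roots fixed by all even powers of Frobenius. -/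
lemma exists_sq_eq (h : IsFormSetup p m n k d ψ) {u : F} (hu : u ^ p = u) (hu0 : u ≠ 0) :
    ∃ v : F, v ≠ 0 ∧ v ^ 2 = u ∧ ∀ j, 2 ∣ j → v ^ p ^ j = v := by
  have hc : ringChar F ≠ 2 := by
    rw [ringChar.eq F p]
    rintro rfl
    exact absurd h.odd (by norm_num)
  have hsq : IsSquare u := by
    rw [FiniteField.isSquare_iff hc hu0, h.card, h.n_eq]
    have h1 : u ^ (p ^ m - 1) = 1 := by
      have h2 : u ^ p ^ m = u := pow_fixed_of_dvd (i := 1) (by simpa using hu) (one_dvd m)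
      apply mul_right_cancel₀ hu0
      rw [← pow_succ, Nat.sub_add_cancel (Nat.one_le_pow _ _ hp.out.pos), h2, one_mul]
    obtain ⟨t, ht⟩ := (Nat.odd_iff.2 h.odd).pow (n := m)
    have h3 : p ^ (2 * m) / 2 = (p ^ m - 1) * (t + 1) := by
      rw [mul_comm 2 m, pow_mul, ht]
      have : (2 * t + 1) ^ 2 = 2 * ((2 * t + 1 - 1) * (t + 1)) + 1 := by
        rw [Nat.add_sub_cancel]
        ring
      omega
    rw [h3, pow_mul, h1, one_pow]
  obtain ⟨v, hv⟩ := hsq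
  have hv2 : v ^ 2 = u := by rw [hv, sq]
  refine ⟨v, ?_, hv2, fun j hj => ?_⟩
  · rintro rfl
    simp at hv
    exact hu0 hv
  · refine pow_fixed_of_dvd (i := 2) ?_ hj
    have h1 : (v ^ p) ^ 2 = v ^ 2 := by rw [← pow_mul, mul_comm, pow_mul, hv2, hu]
    rw [sq p, pow_mul]
    rcases sq_eq_sq_iff_eq_or_eq_neg.1 h1 with h2 | h2
    · rw [h2, h2]
    · rw [h2, (Nat.odd_iff.2 h.odd).neg_pow, h2, neg_neg]

lemma quadSum_smul (h : IsFormSetup p m n k d ψ) {u : F} (hu : u ^ p = u) (hu0 : u ≠ 0)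
    (α β : F) : quadSum ψ p m k (u * α) (u * β) 0 = quadSum ψ p m k α β 0 := by
  obtain ⟨v, hv0, hv, hvj⟩ := h.exists_sq_eq hu hu0
  rw [← quadSum_scale ψ p m k α β hv0, pow_succ, pow_succ, hvj m (h.two_dvd.trans h.dvd_left),
    hvj k (h.two_dvd.trans h.dvd_right), ← sq, hv, mul_comm α, mul_comm β]

lemma sq_quadSum (h : IsFormSetup p m n k d ψ) {α : F} (hα : α ^ p ^ m = α) (β : F) :
    quadSum ψ p m k α β 0 ^ 2 = (p : ℂ) ^ n * kerCard p m n k α β := by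
  have h1 := h.quadSum_mul_neg hα β 0
  have h2 : ∑ y, ψ (-(quadVal p m k α β y + 0 * y)) = quadSum ψ p m k α β 0 := by
    rw [← h.quadSum_smul (u := -1) (by rw [(Nat.odd_iff.2 h.odd).neg_one_pow]) (by simp)]
    refine Finset.sum_congr rfl fun y _ => ?_
    congr 1
    simp only [quadVal]
    ring
  rw [h2, ← sq] at h1
  exact h1

lemma kerCard_pos (α β : F) : 0 < kerCard p m n k α β :=
  Finset.card_pos.2 ⟨0, by simp [phiMap_zero]⟩

lemma quadSum_real (h : IsFormSetup p m n k d ψ) {α : F} (hα : α ^ p ^ m = α) (β : F) :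
    ∃ t : ℝ, quadSum ψ p m k α β 0 = t ∧ t ^ 2 = (p : ℝ) ^ n * kerCard p m n k α β ∧ t ≠ 0 := by
  have h1 := h.sq_quadSum hα β
  set r : ℝ := (p : ℝ) ^ n * kerCard p m n k α β with hr
  have hpos : 0 < r := mul_pos (pow_pos (Nat.cast_pos.2 hp.out.pos) _)
    (Nat.cast_pos.2 (kerCard_pos α β))
  have h2 : quadSum ψ p m k α β 0 ^ 2 = ((√r : ℝ) : ℂ) ^ 2 := by
    rw [h1, ← Complex.ofReal_pow, Real.sq_sqrt hpos.le, hr]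
    push_cast
    rfl
  have h3 := (Real.sqrt_pos.2 hpos).ne'
  rcases sq_eq_sq_iff_eq_or_eq_neg.1 h2 with h4 | h4
  · exact ⟨√r, h4, Real.sq_sqrt hpos.le, h3⟩
  · exact ⟨-√r, by simpa using h4, by rw [neg_sq, Real.sq_sqrt hpos.le], neg_ne_zero.2 h3⟩

lemma card_left (h : IsFormSetup p m n k d ψ) : Fintype.card (frobFixed F p m) = p ^ m := by
  rw [card_frobFixed h.card, h.n_eq, Nat.gcd_mul_left_left]

lemma card_right (h : IsFormSetup p m n k d ψ) :
    Fintype.card (frobFixed F p (m + k)) = p ^ d := by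
  rw [card_frobFixed h.card, h.gcd_add]

lemma fixed_of_fixed (h : IsFormSetup p m n k d ψ) {x : F} (hx : x ^ p ^ (m + k) = x) :
    x ^ p ^ m = x := by
  refine pow_fixed_of_dvd (pow_gcd_fixed (h.pow_n x) hx) ?_
  rw [h.gcd_add]
  exact h.dvd_left

/-- Restriction of an additive character of `F`, twisted by `a`, to a subfield. -/
def restrict (ψ : AddChar F ℂ) (K : Subfield F) (a : F) : AddChar K ℂ :=
  ψ.compAddMonoidHom ((AddMonoidHom.mulLeft a).comp K.subtype.toAddMonoidHom)

lemma restrict_apply (K : Subfield F) (a : F) (c : K) : restrict ψ K a c = ψ (a * c) := rfl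

lemma map_add_conj (h : IsFormSetup p m n k d ψ) (x : F) : ψ ((x + x ^ p ^ m) / 2) = ψ x := by
  have h1 : ψ (x ^ p ^ m / 2) = ψ (x / 2) := by
    rw [← h.map_pow m (x / 2), div_pow, two_pow]
  have : NeZero (2 : F) := ⟨h.two_ne_zero⟩
  rw [add_div, AddChar.map_add_eq_mul, h1, ← AddChar.map_add_eq_mul, add_halves]

lemma sum_left (h : IsFormSetup p m n k d ψ) {y : F} (hy : y ^ p ^ m = y) :
    ∑ a : frobFixed F p m, ψ (a * y) = if y = 0 then (p : ℂ) ^ m else 0 := by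
  have hne : restrict ψ (frobFixed F p m) 1 ≠ 1 := by
    intro h1
    apply h.ne_one
    ext x
    have hx : (x + x ^ p ^ m) / 2 ∈ frobFixed F p m := by
      rw [mem_frobFixed, div_pow, add_pow_char_pow, h.pow_m_m, two_pow, add_comm]
    have h2 := DFunLike.congr_fun h1 ⟨_, hx⟩
    rw [restrict_apply, one_mul] at h2
    rw [← h.map_add_conj]
    exact h2
  have h1 := sum_mul_addChar hne ⟨y, mem_frobFixed.2 hy⟩
  simp only [restrict_apply, one_mul, Subfield.coe_mul] at h1
  rw [h1, h.card_left]
  simp [← Subtype.val_inj]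

lemma exists_norm_eq (h : IsFormSetup p m n k d ψ) {b : F} (hb : b ^ p ^ m = b) (hb0 : b ≠ 0) :
    ∃ w : F, w ≠ 0 ∧ w ^ (p ^ m + 1) = b := by
  have hP : 1 < p ^ m := Nat.one_lt_pow h.pos.ne' hp.out.one_lt
  obtain ⟨Q, hQ⟩ : ∃ Q, p ^ m = Q + 1 := ⟨p ^ m - 1, by omega⟩
  have hcard : Nat.card Fˣ = Q * (p ^ m + 1) := by
    rw [Nat.card_units, Nat.card_eq_fintype_card, h.card, h.n_eq, mul_comm 2 m, pow_mul, hQ]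
    have : (Q + 1) ^ 2 = Q * (Q + 1 + 1) + 1 := by ring
    omega
  have h1 := IsCyclic.card_powMonoidHom_range Fˣ (p ^ m + 1)
  rw [hcard, Nat.gcd_mul_left_left, Nat.mul_div_cancel _ (by positivity)] at h1
  have h2 := IsCyclic.card_powMonoidHom_ker Fˣ Q
  rw [hcard, Nat.gcd_mul_right_left] at h2
  have hle : (powMonoidHom (p ^ m + 1) : Fˣ →* Fˣ).range ≤ (powMonoidHom Q : Fˣ →* Fˣ).ker := by
    rintro _ ⟨u, rfl⟩
    rw [MonoidHom.mem_ker, powMonoidHom_apply, powMonoidHom_apply, ← pow_mul, mul_comm, ← hcard,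
      pow_card_eq_one']
  have heq := Subgroup.eq_of_le_of_card_ge hle (by rw [h1, h2])
  have hmem : Units.mk0 b hb0 ∈ (powMonoidHom Q : Fˣ →* Fˣ).ker := by
    rw [MonoidHom.mem_ker]
    ext
    apply mul_right_cancel₀ hb0
    simp only [powMonoidHom_apply, Units.val_pow_eq_pow_val, Units.val_mk0, Units.val_one]
    rw [← pow_succ, ← hQ, hb, one_mul]
  rw [← heq] at hmem
  obtain ⟨w, hw⟩ := hmem
  refine ⟨w, w.ne_zero, ?_⟩
  simpa using congrArg (fun u : Fˣ => (u : F)) hw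

/-- The character sum of a nonzero Hermitian form in one variable. -/
lemma sum_norm (h : IsFormSetup p m n k d ψ) {b : F} (hb : b ^ p ^ m = b) (hb0 : b ≠ 0) :
    ∑ z, ψ (b * z ^ (p ^ m + 1) / 2) = -(p : ℂ) ^ m := by
  have hscale : ∀ {a : F}, a ^ p ^ m = a → a ≠ 0 →
      ∑ z, ψ (a * z ^ (p ^ m + 1) / 2) = ∑ z, ψ (z ^ (p ^ m + 1) / 2) := by
    intro a ha ha0
    obtain ⟨w, hw0, rfl⟩ := h.exists_norm_eq ha ha0
    refine Fintype.sum_equiv (Equiv.mulLeft₀ w hw0) _ _ fun z => ?_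
    rw [Equiv.mulLeft₀_apply, mul_pow]
  rw [hscale hb hb0]
  have h1 : ∑ a : frobFixed F p m, ∑ z, ψ (a * z ^ (p ^ m + 1) / 2) = (p : ℂ) ^ m := by
    rw [Finset.sum_comm]
    have : ∀ z : F, ∑ a : frobFixed F p m, ψ (a * z ^ (p ^ m + 1) / 2) =
        if z = 0 then (p : ℂ) ^ m else 0 := by
      intro z
      simp_rw [mul_div_assoc]
      rw [h.sum_left]
      · simp [h.two_ne_zero]
      · rw [div_pow, two_pow, pow_succ, mul_pow, h.pow_m_m, mul_comm]
    simp [this]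
  rw [← Finset.add_sum_erase _ _ (Finset.mem_univ (0 : frobFixed F p m))] at h1
  have h2 : ∑ a ∈ Finset.univ.erase (0 : frobFixed F p m), ∑ z, ψ (a * z ^ (p ^ m + 1) / 2) =
      ((p : ℂ) ^ m - 1) * ∑ z, ψ (z ^ (p ^ m + 1) / 2) := by
    rw [Finset.sum_congr rfl fun a ha => hscale (mem_frobFixed.1 a.2)
      (by simpa using Finset.ne_of_mem_erase ha), Finset.sum_const,
      Finset.card_erase_of_mem (Finset.mem_univ _), Finset.card_univ, h.card_left, nsmul_eq_mul,
      Nat.cast_sub (Nat.one_le_pow _ _ hp.out.pos)]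
    push_cast
    rfl
  have h3 : ∑ z : F, ψ ((0 : frobFixed F p m) * z ^ (p ^ m + 1) / 2) = (p : ℂ) ^ m * p ^ m := by
    simp [h.card, h.n_eq, _root_.two_mul, pow_add]
  rw [h2, h3] at h1
  have h4 : (p : ℂ) ^ m - 1 ≠ 0 := by
    rw [sub_ne_zero]
    exact_mod_cast (Nat.one_lt_pow h.pos.ne' hp.out.one_lt).ne'
  apply mul_left_cancel₀ h4
  linear_combination h1

/-- Fibres of the additive map `x ↦ x^{p^{m+k}} - x` as a character sum. -/
lemma card_fiber_frob (h : IsFormSetup p m n k d ψ) (z : F) :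
    ((Finset.univ.filter fun x : F => x ^ p ^ (m + k) - x = z).card : ℂ) =
      ∑ c : frobFixed F p (m + k), ψ (-(c * z)) := by
  have hpn : (p : ℂ) ^ n ≠ 0 := pow_ne_zero _ (Nat.cast_ne_zero.2 hp.out.ne_zero)
  apply mul_left_cancel₀ hpn
  have hbij : Function.Bijective (iterateFrobenius F p (m + k)) :=
    Finite.injective_iff_bijective.1 (RingHom.injective _)
  have h1 : ∑ x : F, ∑ w : F, ψ ((x ^ p ^ (m + k) - x - z) * w ^ p ^ (m + k)) =
      (p : ℂ) ^ n * ((Finset.univ.filter fun x : F => x ^ p ^ (m + k) - x = z).card : ℂ) := by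
    have : ∀ x : F, ∑ w : F, ψ ((x ^ p ^ (m + k) - x - z) * w ^ p ^ (m + k)) =
        ∑ w, ψ ((x ^ p ^ (m + k) - x - z) * w) := fun x =>
      Fintype.sum_bijective _ hbij _ _ fun w => by rw [iterateFrobenius_def]
    simp_rw [this, h.sum_mul, sub_eq_zero]
    rw [← Finset.sum_filter, Finset.sum_const, nsmul_eq_mul, mul_comm]
  have h2 : ∑ c : frobFixed F p (m + k), ψ (-(c * z)) =
      ∑ c ∈ Finset.univ.filter (fun c : F => c ^ p ^ (m + k) = c), ψ (-(c * z)) :=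
    (Finset.sum_subtype _ (fun c => by simp [mem_frobFixed]) fun c => ψ (-(c * z))).symm
  rw [← h1, h2, Finset.sum_comm, Finset.mul_sum, Finset.sum_filter]
  refine Finset.sum_congr rfl fun w _ => ?_
  have h3 : ∀ x : F, ψ ((x ^ p ^ (m + k) - x - z) * w ^ p ^ (m + k)) =
      ψ (-(w ^ p ^ (m + k) * z)) * ψ ((w - w ^ p ^ (m + k)) * x) := by
    intro x
    have e : (x ^ p ^ (m + k) - x - z) * w ^ p ^ (m + k) =
        (x * w) ^ p ^ (m + k) + (-(w ^ p ^ (m + k) * z) + -(w ^ p ^ (m + k) * x)) := by ring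
    have e' : (w - w ^ p ^ (m + k)) * x = x * w + -(w ^ p ^ (m + k) * x) := by ring
    rw [e, e']
    simp only [AddChar.map_add_eq_mul, h.map_pow]
    ring
  simp_rw [h3]
  rw [← Finset.mul_sum, h.sum_mul, sub_eq_zero, eq_comm (a := w)]
  split_ifs with hw
  · rw [hw, mul_comm]
  · ring

lemma pow_add_m (h : IsFormSetup p m n k d ψ) (x : F) : (x ^ p ^ (m + k)) ^ p ^ m = x ^ p ^ k := by
  rw [pow_add, pow_mul, ← pow_mul _ (p ^ k), mul_comm (p ^ k), pow_mul, h.pow_m_m]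

lemma neg_pow (h : IsFormSetup p m n k d ψ) (j : ℕ) (x : F) : (-x) ^ p ^ j = -x ^ p ^ j :=
  ((Nat.odd_iff.2 h.odd).pow).neg_pow x

/-- The coefficient `α` for which `1` lies in the kernel of `φ_{α,b}`. -/
lemma map_quadVal_normal (h : IsFormSetup p m n k d ψ) {b : F} (hb : b ^ p ^ m = b) (x : F) :
    ψ (quadVal p m k (-(b ^ p ^ (n - k) + b)) b x) =
      ψ (-b * (x ^ p ^ (m + k) - x) ^ (p ^ m + 1) / 2) := by
  have e1 : ψ (-(b ^ p ^ (n - k)) * x ^ (p ^ m + 1) / 2) =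
      ψ (-b * (x ^ (p ^ m + 1)) ^ p ^ k / 2) := by
    rw [← h.map_pow k, div_pow, mul_pow, two_pow, h.neg_pow, h.pow_sub_k]
  have e2 : ψ (b * x ^ (p ^ k + 1) / 2) = ψ (b * (x ^ p ^ m * x ^ p ^ (m + k)) / 2) := by
    rw [← h.map_pow m, div_pow, mul_pow, two_pow, hb, pow_succ x, mul_pow, ← pow_mul x (p ^ k),
      ← pow_add p, add_comm k, mul_comm (x ^ p ^ m)]
  have e3 : quadVal p m k (-(b ^ p ^ (n - k) + b)) b x =
      -(b ^ p ^ (n - k)) * x ^ (p ^ m + 1) / 2 + -b * x ^ (p ^ m + 1) / 2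
        + b * x ^ (p ^ k + 1) / 2 + b * x ^ (p ^ k + 1) / 2 := by
    have := h.two_ne_zero
    simp only [quadVal]
    field_simp
    ring
  have e4 : -b * (x ^ p ^ (m + k) - x) ^ (p ^ m + 1) / 2 =
      -b * (x ^ (p ^ m + 1)) ^ p ^ k / 2 + -b * x ^ (p ^ m + 1) / 2
        + b * x ^ (p ^ k + 1) / 2 + b * (x ^ p ^ m * x ^ p ^ (m + k)) / 2 := by
    have e5 : (x ^ (p ^ m + 1)) ^ p ^ k = x ^ p ^ (m + k) * x ^ p ^ k := by
      rw [pow_succ x, mul_pow, ← pow_mul x (p ^ m), ← pow_add p]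
    rw [e5, pow_succ (x ^ p ^ (m + k) - x), sub_pow_char_pow, h.pow_add_m]
    ring
  rw [e3, e4]
  simp only [AddChar.map_add_eq_mul, e1]
  rw [← e2]

/-- The quadratic Gauss sum over the fixed field of `x ↦ x^{p^{m+k}}`. -/
def subGaussSum (ψ : AddChar F ℂ) (p m k : ℕ) [CharP F p] [Fact p.Prime] (a : F) : ℂ :=
  ∑ c : frobFixed F p (m + k), ψ (a * c ^ 2)

lemma quadSum_normal (h : IsFormSetup p m n k d ψ) {b : F} (hb : b ^ p ^ m = b) (hb0 : b ≠ 0) :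
    quadSum ψ p m k (-(b ^ p ^ (n - k) + b)) b 0 =
      -(p : ℂ) ^ m * subGaussSum ψ p m k (2 * b)⁻¹ := by
  have h1 : quadSum ψ p m k (-(b ^ p ^ (n - k) + b)) b 0 =
      ∑ z, ∑ c : frobFixed F p (m + k), ψ (-(c * z)) * ψ (-b * z ^ (p ^ m + 1) / 2) := by
    simp only [quadSum, zero_mul, add_zero, h.map_quadVal_normal hb]
    rw [← Finset.sum_fiberwise (s := Finset.univ) (g := fun x : F => x ^ p ^ (m + k) - x)]
    refine Finset.sum_congr rfl fun z _ => ?_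
    rw [← Finset.sum_mul, ← h.card_fiber_frob, ← nsmul_eq_mul, ← Finset.sum_const]
    refine Finset.sum_congr rfl fun x hx => ?_
    rw [(Finset.mem_filter.1 hx).2]
  rw [h1, Finset.sum_comm, subGaussSum, Finset.mul_sum]
  refine Finset.sum_congr rfl fun c _ => ?_
  have hc : (c : F) ^ p ^ m = c := h.fixed_of_fixed (mem_frobFixed.1 c.2)
  rw [← h.sum_norm (b := -b) (by rw [h.neg_pow, hb]) (neg_ne_zero.2 hb0), Finset.sum_mul]
  refine (Fintype.sum_equiv (Equiv.subRight (c / b : F)) _ _ fun w => ?_).symm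
  have e1 : (w - c / b) ^ (p ^ m + 1) = (w ^ p ^ m - c / b) * (w - c / b) := by
    rw [pow_succ, sub_pow_char_pow, div_pow, hb, hc]
  have e2 := h.map_add_conj (c * w)
  rw [mul_pow, hc] at e2
  have e3 : -(c * (w - c / b)) + -b * (w - c / b) ^ (p ^ m + 1) / 2 + c * w =
      (c * w + c * w ^ p ^ m) / 2 + (-b * w ^ (p ^ m + 1) / 2 + (2 * b)⁻¹ * c ^ 2) := by
    have := h.two_ne_zero
    rw [e1]
    field_simp
    ring
  have e4 := congrArg ψ e3
  rw [AddChar.map_add_eq_mul, AddChar.map_add_eq_mul ψ ((c * w + c * w ^ p ^ m) / 2), e2,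
    mul_comm, AddChar.map_add_eq_mul, AddChar.map_add_eq_mul ψ (-b * w ^ (p ^ m + 1) / 2)] at e4
  exact (mul_left_cancel₀ (addChar_apply_ne_zero ψ _) e4).symm

lemma quadSum_zero (h : IsFormSetup p m n k d ψ) : quadSum ψ p m k 0 0 0 = (p : ℂ) ^ n := by
  simp [quadSum, quadVal, h.card]

lemma le_left (h : IsFormSetup p m n k d ψ) : d ≤ m := Nat.le_of_dvd h.pos h.dvd_left

lemma half_add_half (h : IsFormSetup p m n k d ψ) : d / 2 + d / 2 = d := by
  have := h.even
  omega

lemma cast_pow_injective (p : ℕ) [hp : Fact p.Prime] : Function.Injective fun j => (p : ℂ) ^ j := by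
  intro i j hij
  have h1 : p ^ i = p ^ j := by exact_mod_cast (show (p : ℂ) ^ i = (p : ℂ) ^ j from hij)
  exact Nat.pow_right_injective hp.out.two_le h1

lemma cast_pow_ne_neg (i j : ℕ) : (p : ℂ) ^ i ≠ -(p : ℂ) ^ j := by
  rw [Ne, eq_neg_iff_add_eq_zero]
  have := pow_pos hp.out.pos i
  exact_mod_cast (by omega : p ^ i + p ^ j ≠ 0)

lemma subfield_two_ne_zero (h : IsFormSetup p m n k d ψ) (K : Subfield F) : (2 : K) ≠ 0 :=
  fun h0 => h.two_ne_zero (congrArg Subtype.val h0)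

lemma subGaussSum_of_restrict (h : IsFormSetup p m n k d ψ) {a : F}
    (ha : restrict ψ (frobFixed F p (m + k)) a = 1) : subGaussSum ψ p m k a = (p : ℂ) ^ d := by
  have : ∀ c : frobFixed F p (m + k), ψ (a * c ^ 2) = 1 := fun c => by
    have := DFunLike.congr_fun ha (c ^ 2)
    rwa [restrict_apply] at this
  simp [subGaussSum, this, h.card_right]

lemma sq_subGaussSum (h : IsFormSetup p m n k d ψ) {a : F}
    (ha : restrict ψ (frobFixed F p (m + k)) a ≠ 1) :
    subGaussSum ψ p m k a ^ 2 = (p : ℂ) ^ d := by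
  obtain ⟨v, -, hv, hvj⟩ := h.exists_sq_eq (u := -1)
    (by rw [(Nat.odd_iff.2 h.odd).neg_one_pow]) (by simp)
  have h2 : (2 : frobFixed F p (m + k)) ≠ 0 := h.subfield_two_ne_zero _
  have := sq_sum_addChar_sq ha h2
    (ι := ⟨v, mem_frobFixed.2 (hvj _ (h.two_dvd.trans (h.dvd_left.add h.dvd_right)))⟩)
    (Subtype.ext hv)
  rw [h.card_right] at this
  push_cast at this
  exact this

lemma subGaussSum_eq_half (h : IsFormSetup p m n k d ψ) {a : F}
    (ha : restrict ψ (frobFixed F p (m + k)) a ≠ 1) :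
    subGaussSum ψ p m k a = (p : ℂ) ^ (d / 2) ∨ subGaussSum ψ p m k a = -(p : ℂ) ^ (d / 2) := by
  rw [← sq_eq_sq_iff_eq_or_eq_neg, h.sq_subGaussSum ha, sq, ← pow_add, h.half_add_half]

lemma subGaussSum_eq_full_iff (h : IsFormSetup p m n k d ψ) (a : F) :
    subGaussSum ψ p m k a = (p : ℂ) ^ d ↔ restrict ψ (frobFixed F p (m + k)) a = 1 := by
  refine ⟨fun h1 => ?_, h.subGaussSum_of_restrict⟩
  by_contra ha
  rcases h.subGaussSum_eq_half ha with h2 | h2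
  · have h3 := cast_pow_injective p (h1.symm.trans h2)
    have := h.d_pos
    omega
  · exact cast_pow_ne_neg _ _ (h1.symm.trans h2)

lemma sum_eq_card_mul {A : Type} [Fintype A] (f : A → ℂ) {u v : ℂ} (hu : u ≠ 0) (huv : u ≠ v)
    (huv' : -u ≠ v) (hf : ∀ a, f a = u ∨ f a = -u ∨ f a = v) :
    ∑ a, f a = v * (Finset.univ.filter fun a => f a = v).card +
        u * ((Finset.univ.filter fun a => f a = u).card
          - (Finset.univ.filter fun a => f a = -u).card) ∧
      Fintype.card A = (Finset.univ.filter fun a => f a = v).card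
        + (Finset.univ.filter fun a => f a = u).card
        + (Finset.univ.filter fun a => f a = -u).card := by
  have hneg : u ≠ -u := fun h0 => hu (self_eq_neg.1 h0)
  constructor
  · simp only [Finset.card_filter, Nat.cast_sum, ← Finset.sum_sub_distrib, Finset.mul_sum,
      ← Finset.sum_add_distrib]
    refine Finset.sum_congr rfl fun a _ => ?_
    rcases hf a with h1 | h1 | h1 <;> simp [h1, huv, huv', huv.symm, huv'.symm, hneg, hneg.symm]
  · rw [Fintype.card, Finset.card_eq_sum_ones]
    simp only [Finset.card_filter, ← Finset.sum_add_distrib]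
    refine Finset.sum_congr rfl fun a _ => ?_
    rcases hf a with h1 | h1 | h1 <;> simp [h1, huv, huv', huv.symm, huv'.symm, hneg, hneg.symm]

lemma card_subGaussSum_full (h : IsFormSetup p m n k d ψ) :
    (Finset.univ.filter fun a : frobFixed F p m => subGaussSum ψ p m k a = (p : ℂ) ^ d).card =
      p ^ (m - d) := by
  have h1 : ∑ a : frobFixed F p m, ∑ c : frobFixed F p (m + k), ψ (a * c) =
      (Finset.univ.filter fun a : frobFixed F p m =>
        subGaussSum ψ p m k a = (p : ℂ) ^ d).card * (p : ℂ) ^ d := by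
    rw [← nsmul_eq_mul, ← Finset.sum_const, Finset.sum_filter]
    refine Finset.sum_congr rfl fun a _ => ?_
    simp only [h.subGaussSum_eq_full_iff]
    have := AddChar.sum_eq_ite (restrict ψ (frobFixed F p (m + k)) (a : F))
    rw [h.card_right] at this
    simp only [restrict_apply] at this
    rw [this]
    simp only [AddChar.one_eq_zero]
    push_cast
    rfl
  have h2 : ∑ a : frobFixed F p m, ∑ c : frobFixed F p (m + k), ψ (a * c) = (p : ℂ) ^ m := by
    rw [Finset.sum_comm, Finset.sum_congr rfl fun (c : frobFixed F p (m + k)) _ =>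
      h.sum_left (h.fixed_of_fixed (mem_frobFixed.1 c.2))]
    simp
  rw [h2] at h1
  have h3 : p ^ m = (Finset.univ.filter fun a : frobFixed F p m =>
        subGaussSum ψ p m k a = (p : ℂ) ^ d).card * p ^ d := by exact_mod_cast h1
  rw [← Nat.sub_add_cancel h.le_left, pow_add] at h3
  have h4 := Nat.eq_of_mul_eq_mul_right (pow_pos hp.out.pos d) h3
  rw [Nat.sub_add_cancel h.le_left] at h4
  exact h4.symm

lemma card_subGaussSum_half (h : IsFormSetup p m n k d ψ) :
    2 * (Finset.univ.filter fun a : frobFixed F p m =>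
        subGaussSum ψ p m k a = (p : ℂ) ^ (d / 2)).card + p ^ (m - d) = p ^ m ∧
    2 * (Finset.univ.filter fun a : frobFixed F p m =>
        subGaussSum ψ p m k a = -(p : ℂ) ^ (d / 2)).card + p ^ (m - d) = p ^ m := by
  have hu : (p : ℂ) ^ (d / 2) ≠ 0 := pow_ne_zero _ (Nat.cast_ne_zero.2 hp.out.ne_zero)
  obtain ⟨h1, h2⟩ := sum_eq_card_mul (fun a : frobFixed F p m => subGaussSum ψ p m k a) hu
    (v := (p : ℂ) ^ d)
    (fun h0 => by
      have := cast_pow_injective p h0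
      have := h.d_pos
      omega)
    (fun h0 => cast_pow_ne_neg _ _ h0.symm)
    (fun a => by
      by_cases ha : restrict ψ (frobFixed F p (m + k)) a = 1
      · exact Or.inr (Or.inr (h.subGaussSum_of_restrict ha))
      · rcases h.subGaussSum_eq_half ha with h3 | h3 <;> simp [h3])
  have h3 : ∑ a : frobFixed F p m, subGaussSum ψ p m k a = (p : ℂ) ^ m := by
    simp only [subGaussSum]
    rw [Finset.sum_comm, Finset.sum_congr rfl fun (c : frobFixed F p (m + k)) _ =>
      h.sum_left (y := c ^ 2) (by
        rw [← pow_mul, mul_comm, pow_mul, h.fixed_of_fixed (mem_frobFixed.1 c.2)])]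
    simp
  rw [h3, h.card_subGaussSum_full, Nat.cast_pow, ← pow_add, Nat.add_sub_cancel' h.le_left,
    left_eq_add, mul_eq_zero, or_iff_right hu, sub_eq_zero, Nat.cast_inj] at h1
  rw [h.card_left, h.card_subGaussSum_full] at h2
  omega

/-- Value of the quadratic sum at the pair with second coefficient `b` having `1` in its kernel. -/
def normalSum (ψ : AddChar F ℂ) (p m n k : ℕ) (b : F) : ℂ :=
  quadSum ψ p m k (-(b ^ p ^ (n - k) + b)) b 0

lemma normalSum_zero (h : IsFormSetup p m n k d ψ) : normalSum ψ p m n k 0 = (p : ℂ) ^ n := by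
  have : (0 : F) ^ p ^ (n - k) = 0 := zero_pow (pow_pos hp.out.pos _).ne'
  rw [normalSum, this, add_zero, neg_zero, h.quadSum_zero]

lemma subGaussSum_zero (h : IsFormSetup p m n k d ψ) :
    subGaussSum ψ p m k 0 = (p : ℂ) ^ d := by
  simp [subGaussSum, h.card_right]

lemma normalSum_eq (h : IsFormSetup p m n k d ψ) {b : F} (hb : b ^ p ^ m = b) :
    normalSum ψ p m n k b = (p : ℂ) ^ n ∨ normalSum ψ p m n k b = -(p : ℂ) ^ (m + d) ∨
      normalSum ψ p m n k b = (p : ℂ) ^ (m + d / 2) ∨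
      normalSum ψ p m n k b = -(p : ℂ) ^ (m + d / 2) := by
  rcases eq_or_ne b 0 with rfl | hb0
  · exact Or.inl h.normalSum_zero
  rw [normalSum, h.quadSum_normal hb hb0]
  by_cases ha : restrict ψ (frobFixed F p (m + k)) (2 * b)⁻¹ = 1
  · rw [h.subGaussSum_of_restrict ha, neg_mul, ← pow_add]
    simp
  · rcases h.subGaussSum_eq_half ha with h3 | h3 <;> rw [h3] <;> simp [pow_add]

lemma card_normalSum (h : IsFormSetup p m n k d ψ) {g : ℂ} (hg : -(p : ℂ) ^ m * g ≠ (p : ℂ) ^ n) :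
    (Finset.univ.filter fun b : frobFixed F p m =>
        normalSum ψ p m n k b = -(p : ℂ) ^ m * g).card + (if (p : ℂ) ^ d = g then 1 else 0) =
      (Finset.univ.filter fun a : frobFixed F p m => subGaussSum ψ p m k a = g).card := by
  have hinv : Function.Bijective fun b : frobFixed F p m => (2 * b)⁻¹ := by
    have h2 : (2 : frobFixed F p m) ≠ 0 := h.subfield_two_ne_zero _
    exact inv_involutive.bijective.comp (mulLeft_bijective₀ _ h2)
  have hpm : -(p : ℂ) ^ m ≠ 0 :=
    neg_ne_zero.2 (pow_ne_zero _ (Nat.cast_ne_zero.2 hp.out.ne_zero))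
  have h1 : (if (p : ℂ) ^ d = g then 1 else 0) =
      ∑ b : frobFixed F p m, if b = 0 then (if (p : ℂ) ^ d = g then 1 else 0) else 0 := by
    rw [Finset.sum_ite_eq' Finset.univ, if_pos (Finset.mem_univ _)]
  rw [h1, Finset.card_filter, Finset.card_filter, ← Finset.sum_add_distrib]
  refine Fintype.sum_bijective _ hinv _ _ fun b => ?_
  rcases eq_or_ne b 0 with rfl | hb0
  · simpa [h.normalSum_zero, h.subGaussSum_zero] using fun h0 => hg (by rw [h0, neg_mul])
  · have hb0' : (b : F) ≠ 0 := fun h0 => hb0 (Subtype.ext h0)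
    rw [normalSum, h.quadSum_normal (mem_frobFixed.1 b.2) hb0', if_neg hb0, add_zero]
    simp only [mul_right_inj' hpm]
    congr 1

lemma card_normalSum_full (h : IsFormSetup p m n k d ψ) :
    (Finset.univ.filter fun b : frobFixed F p m =>
      normalSum ψ p m n k b = (p : ℂ) ^ n).card = 1 := by
  rw [Finset.card_eq_one]
  refine ⟨0, Finset.ext fun b => ?_⟩
  simp only [Finset.mem_filter, Finset.mem_univ, true_and, Finset.mem_singleton]
  constructor
  · intro hb
    by_contra hb0
    have hb0' : (b : F) ≠ 0 := fun h0 => hb0 (Subtype.ext h0)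
    have h1 := h.n_eq
    have h2 := h.le_left
    have h3 := h.d_pos
    rw [normalSum, h.quadSum_normal (mem_frobFixed.1 b.2) hb0'] at hb
    by_cases ha : restrict ψ (frobFixed F p (m + k)) (2 * (b : F))⁻¹ = 1
    · rw [h.subGaussSum_of_restrict ha, neg_mul, ← pow_add] at hb
      exact cast_pow_ne_neg _ _ hb.symm
    · rcases h.subGaussSum_eq_half ha with h4 | h4 <;> rw [h4] at hb
      · rw [neg_mul, ← pow_add] at hb
        exact cast_pow_ne_neg _ _ hb.symm
      · rw [neg_mul_neg, ← pow_add] at hb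
        have := cast_pow_injective p hb
        omega
  · rintro rfl
    exact h.normalSum_zero

lemma card_normalSum_neg (h : IsFormSetup p m n k d ψ) :
    (Finset.univ.filter fun b : frobFixed F p m =>
      normalSum ψ p m n k b = -(p : ℂ) ^ (m + d)).card + 1 = p ^ (m - d) := by
  have h1 := h.card_normalSum (g := (p : ℂ) ^ d)
    (by rw [neg_mul, ← pow_add]; exact (cast_pow_ne_neg _ _).symm)
  rwa [neg_mul, ← pow_add, if_pos rfl, h.card_subGaussSum_full] at h1

lemma card_normalSum_half (h : IsFormSetup p m n k d ψ) :
    2 * (Finset.univ.filter fun b : frobFixed F p m =>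
        normalSum ψ p m n k b = (p : ℂ) ^ (m + d / 2)).card + p ^ (m - d) = p ^ m ∧
    2 * (Finset.univ.filter fun b : frobFixed F p m =>
        normalSum ψ p m n k b = -(p : ℂ) ^ (m + d / 2)).card + p ^ (m - d) = p ^ m := by
  have h4 := h.n_eq
  have h2 := h.le_left
  have h3 := h.d_pos
  have h5 := h.card_normalSum (g := (p : ℂ) ^ (d / 2))
    (by rw [neg_mul, ← pow_add]; exact (cast_pow_ne_neg _ _).symm)
  have h6 := h.card_normalSum (g := -(p : ℂ) ^ (d / 2)) (by
    rw [neg_mul_neg, ← pow_add]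
    intro h0
    have := cast_pow_injective p h0
    omega)
  rw [if_neg (fun h0 => by
    have := cast_pow_injective p h0
    omega), add_zero, neg_mul, ← pow_add] at h5
  rw [if_neg (cast_pow_ne_neg _ _), add_zero, neg_mul_neg, ← pow_add] at h6
  rw [h5, h6]
  exact h.card_subGaussSum_half.symm

lemma phiMap_scale (h : IsFormSetup p m n k d ψ) (α β μ x : F) :
    phiMap p m n k (α * μ ^ (p ^ m + 1)) (β * μ ^ (p ^ k + 1)) x =
      μ * phiMap p m n k α β (μ * x) := by
  have e : (β * μ ^ (p ^ k + 1)) ^ p ^ (n - k) = β ^ p ^ (n - k) * (μ * μ ^ p ^ (n - k)) := by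
    rw [mul_pow, pow_succ μ, mul_pow, h.pow_k_sub]
  simp only [phiMap, e, mul_pow]
  ring

lemma fixed_of_phiMap_one (h : IsFormSetup p m n k d ψ) {α β : F} (hα : α ^ p ^ m = α)
    (h1 : phiMap p m n k α β 1 = 0) : β ^ p ^ m = β := by
  obtain ⟨b, rfl⟩ : ∃ b, b ^ p ^ k = β := ⟨_, h.pow_sub_k β⟩
  simp only [phiMap, one_pow, mul_one, h.pow_k_sub] at h1
  have hcomm : ∀ x : F, (x ^ p ^ m) ^ p ^ k = (x ^ p ^ k) ^ p ^ m := fun x => by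
    rw [← pow_mul, mul_comm, pow_mul]
  have h2 : (b ^ p ^ k) ^ p ^ m + b ^ p ^ m = b ^ p ^ k + b := by
    rw [← add_pow_char_pow, show b ^ p ^ k + b = -α by linear_combination h1, h.neg_pow, hα]
  set u := b - b ^ p ^ m with hu
  have h3 : u ^ p ^ m = -u := by
    rw [hu, sub_pow_char_pow, h.pow_m_m, neg_sub]
  have h4 : u ^ p ^ k = -u := by
    rw [hu, sub_pow_char_pow, hcomm]
    linear_combination -h2
  have h5 : u ^ p ^ m = u := h.fixed_of_fixed (by
    rw [pow_add, pow_mul, h3, h.neg_pow, h4, neg_neg])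
  have h6 : u = 0 := by
    have h7 : 2 * u = 0 := by linear_combination h3 - h5
    exact (mul_eq_zero.1 h7).resolve_left h.two_ne_zero
  have h7 : b = b ^ p ^ m := sub_eq_zero.1 h6
  rw [← hcomm, ← h7]

lemma eq_of_phiMap_one {α β : F} (h1 : phiMap p m n k α β 1 = 0) :
    α = -(β ^ p ^ (n - k) + β) := by
  simp only [phiMap, one_pow, mul_one] at h1
  linear_combination h1

lemma norm_fixed (h : IsFormSetup p m n k d ψ) (μ : F) :
    (μ ^ (p ^ m + 1)) ^ p ^ m = μ ^ (p ^ m + 1) := by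
  rw [pow_succ μ, mul_pow, h.pow_m_m, mul_comm]

/-- Forms with a nonzero kernel vector are equivalent to forms in normal position. -/
lemma normal_of_phiMap (h : IsFormSetup p m n k d ψ) {α β μ : F} (hα : α ^ p ^ m = α)
    (hμ : μ ≠ 0) (h0 : phiMap p m n k α β μ = 0) :
    (β * μ ^ (p ^ k + 1)) ^ p ^ m = β * μ ^ (p ^ k + 1) ∧
      α * μ ^ (p ^ m + 1) = -((β * μ ^ (p ^ k + 1)) ^ p ^ (n - k) + β * μ ^ (p ^ k + 1)) ∧
      quadSum ψ p m k α β 0 = normalSum ψ p m n k (β * μ ^ (p ^ k + 1)) := by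
  have h1 : phiMap p m n k (α * μ ^ (p ^ m + 1)) (β * μ ^ (p ^ k + 1)) 1 = 0 := by
    rw [h.phiMap_scale, mul_one, h0, mul_zero]
  have h2 := eq_of_phiMap_one h1
  refine ⟨h.fixed_of_phiMap_one (by rw [mul_pow, hα, h.norm_fixed]) h1, h2, ?_⟩
  rw [normalSum, ← h2, quadSum_scale ψ p m k α β hμ]

lemma quadSum_eq (h : IsFormSetup p m n k d ψ) {α : F} (hα : α ^ p ^ m = α) (β : F) :
    quadSum ψ p m k α β 0 = (p : ℂ) ^ m ∨ quadSum ψ p m k α β 0 = -(p : ℂ) ^ m ∨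
    quadSum ψ p m k α β 0 = (p : ℂ) ^ n ∨ quadSum ψ p m k α β 0 = -(p : ℂ) ^ (m + d) ∨
      quadSum ψ p m k α β 0 = (p : ℂ) ^ (m + d / 2) ∨
      quadSum ψ p m k α β 0 = -(p : ℂ) ^ (m + d / 2) := by
  by_cases hker : ∃ μ : F, μ ≠ 0 ∧ phiMap p m n k α β μ = 0
  · obtain ⟨μ, hμ, h0⟩ := hker
    obtain ⟨h1, -, h2⟩ := h.normal_of_phiMap hα hμ h0
    rw [h2]
    exact Or.inr (Or.inr (h.normalSum_eq h1))
  · have h1 : kerCard p m n k α β = 1 := by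
      rw [kerCard, Finset.card_eq_one]
      refine ⟨0, Finset.ext fun μ => ?_⟩
      simp only [Finset.mem_filter, Finset.mem_univ, true_and, Finset.mem_singleton]
      refine ⟨fun h0 => ?_, ?_⟩
      · by_contra hμ
        exact hker ⟨μ, hμ, h0⟩
      · rintro rfl
        exact phiMap_zero α β
    have h2 := h.sq_quadSum hα β
    rw [h1, Nat.cast_one, mul_one, h.n_eq, mul_comm 2 m, pow_mul] at h2
    rcases sq_eq_sq_iff_eq_or_eq_neg.1 h2 with h3 | h3
    · exact Or.inl h3
    · exact Or.inr (Or.inl h3)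

/-- Pairs `(α, β)` whose quadratic sum takes the value `v`. -/
def formSet (ψ : AddChar F ℂ) (p m k : ℕ) (v : ℂ) : Finset (F × F) :=
  Finset.univ.filter fun ab => ab.1 ^ p ^ m = ab.1 ∧ quadSum ψ p m k ab.1 ab.2 0 = v

lemma mem_formSet {v : ℂ} {ab : F × F} : ab ∈ formSet ψ p m k v ↔
    ab.1 ^ p ^ m = ab.1 ∧ quadSum ψ p m k ab.1 ab.2 0 = v := by
  simp [formSet]

lemma card_formSet_phiMap (h : IsFormSetup p m n k d ψ) (v : ℂ) {μ : F} (hμ : μ ≠ 0) :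
    ((formSet ψ p m k v).filter fun ab => phiMap p m n k ab.1 ab.2 μ = 0).card =
      (Finset.univ.filter fun b : frobFixed F p m => normalSum ψ p m n k b = v).card := by
  have hμ1 : μ ^ (p ^ m + 1) ≠ 0 := pow_ne_zero _ hμ
  have hμ2 : μ ^ (p ^ k + 1) ≠ 0 := pow_ne_zero _ hμ
  refine Finset.card_bij (fun ab hab => ⟨ab.2 * μ ^ (p ^ k + 1), ?_⟩) ?_ ?_ ?_
  · rw [Finset.mem_filter, mem_formSet] at hab
    exact mem_frobFixed.2 (h.normal_of_phiMap hab.1.1 hμ hab.2).1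
  · intro ab hab
    rw [Finset.mem_filter, mem_formSet] at hab
    simp only [Finset.mem_filter, Finset.mem_univ, true_and]
    rw [← (h.normal_of_phiMap hab.1.1 hμ hab.2).2.2, hab.1.2]
  · rintro ⟨a, b⟩ hab ⟨a', b'⟩ hab' heq
    rw [Finset.mem_filter, mem_formSet] at hab hab'
    have h1 : b * μ ^ (p ^ k + 1) = b' * μ ^ (p ^ k + 1) := congrArg Subtype.val heq
    have h2 := (h.normal_of_phiMap hab.1.1 hμ hab.2).2.1
    have h3 := (h.normal_of_phiMap hab'.1.1 hμ hab'.2).2.1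
    dsimp only at h2 h3
    rw [h1, ← h3] at h2
    exact Prod.ext (mul_right_cancel₀ hμ1 h2) (mul_right_cancel₀ hμ2 h1)
  · rintro ⟨b, hb⟩ hbv
    simp only [Finset.mem_filter, Finset.mem_univ, true_and] at hbv
    rw [mem_frobFixed] at hb
    have e1 : -(b ^ p ^ (n - k) + b) / μ ^ (p ^ m + 1) * μ ^ (p ^ m + 1) =
      -(b ^ p ^ (n - k) + b) := div_mul_cancel₀ _ hμ1
    have e2 : b / μ ^ (p ^ k + 1) * μ ^ (p ^ k + 1) = b := div_mul_cancel₀ _ hμ2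
    refine ⟨(-(b ^ p ^ (n - k) + b) / μ ^ (p ^ m + 1), b / μ ^ (p ^ k + 1)), ?_, Subtype.ext e2⟩
    rw [Finset.mem_filter, mem_formSet]
    refine ⟨⟨?_, ?_⟩, ?_⟩
    · have : (b ^ p ^ (n - k)) ^ p ^ m = b ^ p ^ (n - k) := by
        rw [← pow_mul, mul_comm, pow_mul, hb]
      simp only [div_pow, h.norm_fixed, h.neg_pow, add_pow_char_pow, this, hb]
    · rw [← quadSum_scale ψ p m k _ _ hμ, e1, e2]
      exact hbv
    · have h4 := h.phiMap_scale (-(b ^ p ^ (n - k) + b) / μ ^ (p ^ m + 1))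
        (b / μ ^ (p ^ k + 1)) μ 1
      rw [e1, e2, mul_one] at h4
      refine (mul_eq_zero.1 (h4.symm.trans ?_)).resolve_left hμ
      simp only [phiMap, one_pow, mul_one]
      ring

lemma card_formSet_mul (h : IsFormSetup p m n k d ψ) {v : ℂ} {c : ℕ}
    (hc : v ^ 2 = (p : ℂ) ^ n * c) :
    (formSet ψ p m k v).card * (c - 1) = (p ^ n - 1) *
      (Finset.univ.filter fun b : frobFixed F p m => normalSum ψ p m n k b = v).card := by
  have hpn : (p : ℂ) ^ n ≠ 0 := pow_ne_zero _ (Nat.cast_ne_zero.2 hp.out.ne_zero)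
  have h1 : ∀ ab ∈ formSet ψ p m k v,
      ((Finset.univ.erase 0).filter fun μ => phiMap p m n k ab.1 ab.2 μ = 0).card = c - 1 := by
    intro ab hab
    rw [mem_formSet] at hab
    have h2 := h.sq_quadSum hab.1 ab.2
    rw [hab.2, hc] at h2
    have h3 : c = kerCard p m n k ab.1 ab.2 := by exact_mod_cast mul_left_cancel₀ hpn h2
    rw [h3, kerCard, Finset.filter_erase, Finset.card_erase_of_mem (by simp [phiMap_zero])]
  rw [← smul_eq_mul, ← Finset.sum_const, ← Finset.sum_congr rfl h1]
  simp only [Finset.card_filter]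
  rw [Finset.sum_comm, Finset.sum_congr rfl fun μ hμ => ?_, Finset.sum_const,
    Finset.card_erase_of_mem (Finset.mem_univ _), Finset.card_univ, h.card, smul_eq_mul]
  rw [← Finset.card_filter, ← Finset.card_filter,
    h.card_formSet_phiMap v (Finset.ne_of_mem_erase hμ)]

lemma card_formSet_full (h : IsFormSetup p m n k d ψ) :
    (formSet ψ p m k ((p : ℂ) ^ n)).card = 1 := by
  have h1 := h.card_formSet_mul (v := (p : ℂ) ^ n) (c := p ^ n) (by push_cast; ring)
  rw [h.card_normalSum_full, mul_comm] at h1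
  have : 1 < p ^ n := Nat.one_lt_pow (by have := h.n_eq; have := h.pos; omega) hp.out.one_lt
  exact Nat.eq_of_mul_eq_mul_left (by omega) h1

lemma card_formSet_neg (h : IsFormSetup p m n k d ψ) :
    (formSet ψ p m k (-(p : ℂ) ^ (m + d))).card * (p ^ (2 * d) - 1) =
      (p ^ n - 1) * (p ^ (m - d) - 1) := by
  rw [h.card_formSet_mul (v := -(p : ℂ) ^ (m + d)) (c := p ^ (2 * d))
    (by rw [h.n_eq]; push_cast; ring)]
  have := h.card_normalSum_neg
  congr 1
  omega

lemma card_formSet_half (h : IsFormSetup p m n k d ψ) :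
    2 * (formSet ψ p m k ((p : ℂ) ^ (m + d / 2))).card * (p ^ d - 1) =
      (p ^ n - 1) * (p ^ m - p ^ (m - d)) ∧
    2 * (formSet ψ p m k (-(p : ℂ) ^ (m + d / 2))).card * (p ^ d - 1) =
      (p ^ n - 1) * (p ^ m - p ^ (m - d)) := by
  have e : ((p : ℂ) ^ (m + d / 2)) ^ 2 = (p : ℂ) ^ n * (p ^ d : ℕ) := by
    rw [Nat.cast_pow, ← pow_mul, ← pow_add, h.n_eq]
    congr 1
    have := h.half_add_half
    omega
  obtain ⟨h1, h2⟩ := h.card_normalSum_half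
  constructor
  · rw [mul_assoc, h.card_formSet_mul e, mul_left_comm]
    congr 1
    omega
  · rw [mul_assoc, h.card_formSet_mul ((neg_sq _).trans e), mul_left_comm]
    congr 1
    omega

/-- Pairs `(α, β)` with `α` in the subfield of size `p^m`. -/
def pairSet (F : Type) [Field F] [Fintype F] (p m : ℕ) : Finset (F × F) :=
  (Finset.univ.filter fun a => a ^ p ^ m = a) ×ˢ Finset.univ

lemma mem_pairSet {ab : F × F} : ab ∈ pairSet F p m ↔ ab.1 ^ p ^ m = ab.1 := by
  simp [pairSet]

lemma card_fixed (h : IsFormSetup p m n k d ψ) :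
    (Finset.univ.filter fun a : F => a ^ p ^ m = a).card = p ^ m := by
  refine Eq.trans ?_ h.card_left
  exact (Fintype.card_of_subtype _ fun x => by simp [mem_frobFixed]).symm

lemma sum_quadSum (h : IsFormSetup p m n k d ψ) :
    ∑ ab ∈ pairSet F p m, quadSum ψ p m k ab.1 ab.2 0 = (p : ℂ) ^ (3 * m) := by
  rw [pairSet, Finset.sum_product]
  have h1 : ∀ a : F, ∑ b, quadSum ψ p m k a b 0 = (p : ℂ) ^ n := by
    intro a
    simp only [quadSum, quadVal, zero_mul, add_zero, AddChar.map_add_eq_mul]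
    rw [Finset.sum_comm, Finset.sum_congr rfl fun x _ => ?_, Finset.sum_ite_eq' Finset.univ (0 : F)
      fun _ => (p : ℂ) ^ n, if_pos (Finset.mem_univ _)]
    rw [← Finset.mul_sum]
    simp_rw [mul_comm _ (x ^ (p ^ k + 1))]
    rw [h.sum_mul]
    rcases eq_or_ne x 0 with rfl | hx <;> simp [*]
  simp only [h1, Finset.sum_const, h.card_fixed, nsmul_eq_mul]
  rw [h.n_eq]
  push_cast
  ring

lemma sum_pairSet (h : IsFormSetup p m n k d ψ) (g : ℂ → ℂ) :
    ∑ ab ∈ pairSet F p m, g (quadSum ψ p m k ab.1 ab.2 0) =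
      (formSet ψ p m k ((p : ℂ) ^ m)).card * g ((p : ℂ) ^ m) +
      (formSet ψ p m k (-(p : ℂ) ^ m)).card * g (-(p : ℂ) ^ m) +
      g ((p : ℂ) ^ n) +
      (formSet ψ p m k (-(p : ℂ) ^ (m + d))).card * g (-(p : ℂ) ^ (m + d)) +
      (formSet ψ p m k ((p : ℂ) ^ (m + d / 2))).card * g ((p : ℂ) ^ (m + d / 2)) +
      (formSet ψ p m k (-(p : ℂ) ^ (m + d / 2))).card * g (-(p : ℂ) ^ (m + d / 2)) := by
  have hn := h.n_eq
  have hm := h.pos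
  have hd := h.le_left
  have hd0 := h.d_pos
  have hd2 := h.half_add_half
  have hinj : ∀ {i j : ℕ}, i ≠ j → (p : ℂ) ^ i ≠ (p : ℂ) ^ j :=
    fun hij => (cast_pow_injective p).ne hij
  have hneg : ∀ {i j : ℕ}, (p : ℂ) ^ i ≠ -(p : ℂ) ^ j := cast_pow_ne_neg _ _
  let V : Finset ℂ := {(p : ℂ) ^ m, -(p : ℂ) ^ m, (p : ℂ) ^ n, -(p : ℂ) ^ (m + d),
    (p : ℂ) ^ (m + d / 2), -(p : ℂ) ^ (m + d / 2)}
  have hV : ∀ ab ∈ pairSet F p m, quadSum ψ p m k ab.1 ab.2 0 ∈ V := by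
    intro ab hab
    simpa [V] using h.quadSum_eq (mem_pairSet.1 hab) ab.2
  have hfib : ∀ v, ∑ ab ∈ pairSet F p m with quadSum ψ p m k ab.1 ab.2 0 = v,
      g (quadSum ψ p m k ab.1 ab.2 0) = (formSet ψ p m k v).card * g v := by
    intro v
    rw [← nsmul_eq_mul, ← Finset.sum_const]
    have : (pairSet F p m).filter (fun ab => quadSum ψ p m k ab.1 ab.2 0 = v) =
        formSet ψ p m k v := by
      ext ab
      rw [Finset.mem_filter, mem_pairSet, mem_formSet]
    rw [this]
    exact Finset.sum_congr rfl fun ab hab => by rw [(mem_formSet.1 hab).2]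
  have hlast : (formSet ψ p m k ((p : ℂ) ^ n)).card * g ((p : ℂ) ^ n) = g ((p : ℂ) ^ n) := by
    rw [h.card_formSet_full, Nat.cast_one, one_mul]
  rw [← Finset.sum_fiberwise_of_maps_to hV, Finset.sum_congr rfl fun v _ => hfib v,
    ← hlast]
  rw [Finset.sum_insert, Finset.sum_insert, Finset.sum_insert, Finset.sum_insert,
    Finset.sum_insert, Finset.sum_singleton]
  · ring
  all_goals
    simp only [Finset.mem_insert, Finset.mem_singleton, not_or, Ne.symm hneg, hneg, neg_inj,
      not_false_eq_true, true_and, and_true]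
    try simp only [← Ne.eq_def]
    try refine ⟨?_, ?_⟩
  all_goals exact hinj (by omega)

lemma card_formSet_half_eq (h : IsFormSetup p m n k d ψ) :
    (formSet ψ p m k (-(p : ℂ) ^ (m + d / 2))).card =
      (formSet ψ p m k ((p : ℂ) ^ (m + d / 2))).card := by
  obtain ⟨h1, h2⟩ := h.card_formSet_half
  have h3 : 1 < p ^ d := Nat.one_lt_pow h.d_pos.ne' hp.out.one_lt
  rw [← h1] at h2
  have := Nat.eq_of_mul_eq_mul_right (by omega) h2
  omega

lemma card_pairSet (h : IsFormSetup p m n k d ψ) :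
    (formSet ψ p m k ((p : ℂ) ^ m)).card + (formSet ψ p m k (-(p : ℂ) ^ m)).card + 1 +
      (formSet ψ p m k (-(p : ℂ) ^ (m + d))).card +
      2 * (formSet ψ p m k ((p : ℂ) ^ (m + d / 2))).card = p ^ (3 * m) := by
  have h1 := h.sum_pairSet fun _ => 1
  rw [h.card_formSet_half_eq, pairSet, Finset.sum_const, Finset.card_product, h.card_fixed,
    Finset.card_univ, h.card, h.n_eq] at h1
  have h2 : p ^ m * p ^ (2 * m) = p ^ (3 * m) := by rw [← pow_add]; congr 1; ring
  rw [← h2, ← Nat.cast_inj (R := ℂ)]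
  push_cast
  simp only [nsmul_eq_mul, mul_one] at h1
  push_cast at h1
  rw [h1]
  ring

lemma first_moment (h : IsFormSetup p m n k d ψ) :
    ((formSet ψ p m k ((p : ℂ) ^ m)).card : ℤ) - (formSet ψ p m k (-(p : ℂ) ^ m)).card +
      (p : ℤ) ^ m - (p : ℤ) ^ d * (formSet ψ p m k (-(p : ℂ) ^ (m + d))).card =
        (p : ℤ) ^ n := by
  have h1 := h.sum_pairSet id
  have hpm : (p : ℂ) ^ m ≠ 0 := pow_ne_zero _ (Nat.cast_ne_zero.2 hp.out.ne_zero)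
  simp only [id] at h1
  rw [h.sum_quadSum, h.card_formSet_half_eq, h.n_eq] at h1
  rw [h.n_eq, ← Int.cast_inj (α := ℂ)]
  apply mul_left_cancel₀ hpm
  push_cast
  rw [← pow_add, show m + 2 * m = 3 * m by ring, h1]
  ring

lemma quadSum_ne_zero (h : IsFormSetup p m n k d ψ) {α : F} (hα : α ^ p ^ m = α) (β : F) :
    quadSum ψ p m k α β 0 ≠ 0 := by
  obtain ⟨t, ht, -, h0⟩ := h.quadSum_real hα β
  rw [ht]
  exact_mod_cast h0

lemma card_fiber_phiMap (α β x₀ : F) :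
    (Finset.univ.filter fun x => phiMap p m n k α β x = phiMap p m n k α β x₀).card =
      kerCard p m n k α β := by
  refine Finset.card_bij' (fun x _ => x - x₀) (fun x _ => x + x₀) ?_ ?_ ?_ ?_
  · intro x hx
    rw [Finset.mem_filter] at hx ⊢
    rw [sub_eq_add_neg, phiMap_add, phiMap_neg, hx.2, add_neg_cancel]
    simp
  · intro x hx
    rw [Finset.mem_filter] at hx ⊢
    rw [phiMap_add, hx.2, zero_add]
    simp
  · simp
  · simp

/-- Nonvanishing sums with linear term, counted through preimages under `φ_{α,β}`. -/
lemma kerCard_mul_card (h : IsFormSetup p m n k d ψ) {α : F} (hα : α ^ p ^ m = α) (β : F)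
    (P : ℂ → Prop) [DecidablePred P] (hP : ∀ w, P w → w ≠ 0) :
    (Finset.univ.filter fun γ => P (quadSum ψ p m k α β γ)).card * kerCard p m n k α β =
      (Finset.univ.filter fun x =>
        P (ψ (-quadVal p m k α β x) * quadSum ψ p m k α β 0)).card := by
  have hmaps : ∀ x ∈ Finset.univ.filter fun x =>
      P (ψ (-quadVal p m k α β x) * quadSum ψ p m k α β 0),
      phiMap p m n k α β x ∈ Finset.univ.filter fun γ => P (quadSum ψ p m k α β γ) := by
    intro x hx
    rw [Finset.mem_filter] at hx ⊢
    rw [h.quadSum_phiMap hα]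
    exact ⟨Finset.mem_univ _, hx.2⟩
  rw [Finset.card_eq_sum_card_fiberwise hmaps, ← smul_eq_mul, ← Finset.sum_const]
  refine Finset.sum_congr rfl fun γ hγ => ?_
  rw [Finset.mem_filter] at hγ
  obtain ⟨x₀, rfl⟩ := h.exists_phiMap_eq hα (hP _ hγ.2)
  rw [← card_fiber_phiMap α β x₀, Finset.filter_filter]
  congr 1
  refine Finset.filter_congr fun x _ => ?_
  refine ⟨fun hx => ⟨?_, hx⟩, fun hx => hx.2⟩
  rw [← h.quadSum_phiMap hα, hx]
  exact hγ.2

lemma sum_range_pow {z : ℂ} (hz : z ^ p = 1) :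
    ∑ i ∈ Finset.range p, z ^ i = if z = 1 then (p : ℂ) else 0 := by
  split_ifs with h1
  · simp [h1]
  · have := geom_sum_mul z p
    rw [hz, sub_self] at this
    exact (mul_eq_zero.1 this).resolve_right (sub_ne_zero.2 h1)

/-- The number of `x` at which the quadratic form takes a prescribed value. -/
lemma card_quadVal (h : IsFormSetup p m n k d ψ) (α β : F) {ξ : ℂ} (hξ : ξ ^ p = 1) :
    (p : ℂ) * (Finset.univ.filter fun x => ψ (-quadVal p m k α β x) = ξ).card =
      (p : ℂ) ^ n + quadSum ψ p m k α β 0 * ((if ξ = 1 then (p : ℂ) else 0) - 1) := by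
  have hξ0 : ξ ≠ 0 := by
    rintro rfl
    rw [zero_pow hp.out.ne_zero] at hξ
    exact zero_ne_one hξ
  have hξi : ξ⁻¹ ^ p = 1 := by rw [inv_pow, hξ, inv_one]
  have h1 : ∀ x, (∑ i ∈ Finset.range p, (ξ⁻¹ * ψ (-quadVal p m k α β x)) ^ i) =
      if ψ (-quadVal p m k α β x) = ξ then (p : ℂ) else 0 := by
    intro x
    rw [sum_range_pow (by rw [mul_pow, hξi, map_pow_p, one_mul])]
    simp only [inv_mul_eq_one₀ hξ0, eq_comm]
  have h2 : (p : ℂ) * (Finset.univ.filter fun x => ψ (-quadVal p m k α β x) = ξ).card =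
      ∑ x, ∑ i ∈ Finset.range p, (ξ⁻¹ * ψ (-quadVal p m k α β x)) ^ i := by
    simp_rw [h1]
    rw [← Finset.sum_filter, Finset.sum_const, nsmul_eq_mul, mul_comm]
  have h3 : ∀ i ∈ (Finset.range p).erase 0,
      ∑ x, (ξ⁻¹ * ψ (-quadVal p m k α β x)) ^ i = ξ⁻¹ ^ i * quadSum ψ p m k α β 0 := by
    intro i hi
    rw [Finset.mem_erase, Finset.mem_range] at hi
    have hi0 : -(i : F) ≠ 0 := by
      rw [neg_ne_zero, Ne, CharP.cast_eq_zero_iff F p]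
      exact fun hdvd => hi.1 (Nat.eq_zero_of_dvd_of_lt hdvd hi.2)
    have hip : (-(i : F)) ^ p = -(i : F) := by
      rw [(Nat.odd_iff.2 h.odd).neg_pow, ← frobenius_def, map_natCast]
    rw [← h.quadSum_smul hip hi0 α β, quadSum, Finset.mul_sum]
    refine Finset.sum_congr rfl fun x _ => ?_
    rw [mul_pow, ← AddChar.map_nsmul_eq_pow, nsmul_eq_mul]
    congr 2
    simp only [quadVal]
    ring
  have h0 : 0 ∈ Finset.range p := Finset.mem_range.2 hp.out.pos
  rw [h2, Finset.sum_comm, ← Finset.add_sum_erase _ _ h0, Finset.sum_congr rfl h3,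
    ← Finset.sum_mul]
  have h4 := sum_range_pow hξi
  rw [← Finset.add_sum_erase _ _ h0, pow_zero] at h4
  simp only [inv_eq_one] at h4
  simp only [pow_zero, Finset.sum_const, Finset.card_univ, h.card, nsmul_eq_mul, mul_one]
  rw [← h4]
  push_cast
  ring

lemma eq_of_mul_eq_mul (h : IsFormSetup p m n k d ψ) {ξ η : ℂ} (hξ : ξ ^ p = 1) (hη : η ^ p = 1)
    {s t : ℝ} (ht : t ≠ 0) (hst : ξ * s = η * t) : s = t ∧ ξ = η := by
  have h1 : s = t := by
    have h2 := congrArg (· ^ p) hst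
    simp only [mul_pow, hξ, hη, one_mul] at h2
    have h3 : s ^ p = t ^ p := by exact_mod_cast h2
    exact (Nat.odd_iff.2 h.odd).strictMono_pow.injective h3
  subst h1
  exact ⟨rfl, mul_right_cancel₀ (by exact_mod_cast ht) hst⟩

/-- Triples `(α, β, γ)` at which the sum takes the value `w`. -/
def sumSet (ψ : AddChar F ℂ) (p m k : ℕ) (w : ℂ) : Finset (F × F × F) :=
  Finset.univ.filter fun abc =>
    abc.1 ^ p ^ m = abc.1 ∧ quadSum ψ p m k abc.1 abc.2.1 abc.2.2 = w

lemma card_sumSet (w : ℂ) : (sumSet ψ p m k w).card =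
    ∑ ab ∈ pairSet F p m, (Finset.univ.filter fun γ => quadSum ψ p m k ab.1 ab.2 γ = w).card := by
  rw [← Finset.card_sigma]
  refine Finset.card_bij' (fun abc _ => ⟨(abc.1, abc.2.1), abc.2.2⟩)
    (fun s _ => (s.1.1, s.1.2, s.2)) ?_ ?_ ?_ ?_
  · intro abc habc
    simpa [sumSet, mem_pairSet] using habc
  · intro s hs
    simpa [sumSet, mem_pairSet] using hs
  · simp
  · simp

lemma card_sumSet_mul (h : IsFormSetup p m n k d ψ) {ξ : ℂ} (hξ : ξ ^ p = 1) {t : ℝ} (ht : t ≠ 0)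
    {c : ℕ} (hc : (t : ℂ) ^ 2 = (p : ℂ) ^ n * c) :
    (p : ℂ) * (sumSet ψ p m k (ξ * t)).card * c = (formSet ψ p m k t).card *
      ((p : ℂ) ^ n + t * ((if ξ = 1 then (p : ℂ) else 0) - 1)) := by
  have hpn : (p : ℂ) ^ n ≠ 0 := pow_ne_zero _ (Nat.cast_ne_zero.2 hp.out.ne_zero)
  have hξ0 : ξ ≠ 0 := by
    rintro rfl
    rw [zero_pow hp.out.ne_zero] at hξ
    exact zero_ne_one hξ
  have hw : ξ * (t : ℂ) ≠ 0 := mul_ne_zero hξ0 (by exact_mod_cast ht)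
  have hset : (pairSet F p m).filter (fun ab => quadSum ψ p m k ab.1 ab.2 0 = t) =
      formSet ψ p m k t := by
    ext ab
    rw [Finset.mem_filter, mem_pairSet, mem_formSet]
  have h1 : ∀ ab ∈ pairSet F p m,
      (p : ℂ) * (Finset.univ.filter fun γ => quadSum ψ p m k ab.1 ab.2 γ = ξ * t).card * c =
        if quadSum ψ p m k ab.1 ab.2 0 = t then
          (p : ℂ) ^ n + t * ((if ξ = 1 then (p : ℂ) else 0) - 1) else 0 := by
    rintro ⟨α, β⟩ hab
    have hα := mem_pairSet.1 hab
    dsimp only at hα ⊢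
    have h2 := h.kerCard_mul_card hα β (· = ξ * t) fun w hw' => hw' ▸ hw
    obtain ⟨s, hs, -, -⟩ := h.quadSum_real hα β
    by_cases hT : quadSum ψ p m k α β 0 = t
    · rw [if_pos hT]
      have h3 : c = kerCard p m n k α β := by
        have h4 := h.sq_quadSum hα β
        rw [hT, hc] at h4
        exact_mod_cast mul_left_cancel₀ hpn h4
      have h5 := h.card_quadVal α β hξ
      rw [hT] at h5 h2
      rw [← h5, mul_assoc, h3]
      have ht' : (t : ℂ) ≠ 0 := by exact_mod_cast ht
      simp only [mul_left_inj' ht'] at h2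
      rw [← h2]
      push_cast
      rfl
    · have h3 : (Finset.univ.filter fun x =>
          ψ (-quadVal p m k α β x) * quadSum ψ p m k α β 0 = ξ * t) = ∅ := by
        refine Finset.filter_eq_empty_iff.2 fun x _ hx => ?_
        rw [hs] at hx hT
        exact hT (by rw [(h.eq_of_mul_eq_mul (map_pow_p _) hξ ht hx).1])
      rw [h3, Finset.card_empty] at h2
      rw [(Nat.mul_eq_zero.1 h2).resolve_right (kerCard_pos α β).ne', if_neg hT]
      simp
  rw [card_sumSet, Nat.cast_sum, Finset.mul_sum, Finset.sum_mul, Finset.sum_congr rfl h1,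
    ← Finset.sum_filter, hset, Finset.sum_const, nsmul_eq_mul]

lemma card_zero (h : IsFormSetup p m n k d ψ) {α : F} (hα : α ^ p ^ m = α) (β : F) :
    ((Finset.univ.filter fun γ => quadSum ψ p m k α β γ = 0).card : ℂ) =
      (p : ℂ) ^ n - (p : ℂ) ^ (2 * n) / quadSum ψ p m k α β 0 ^ 2 := by
  have hpn : (p : ℂ) ^ n ≠ 0 := pow_ne_zero _ (Nat.cast_ne_zero.2 hp.out.ne_zero)
  have hker : (kerCard p m n k α β : ℂ) ≠ 0 := Nat.cast_ne_zero.2 (kerCard_pos α β).ne'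
  have h1 := h.kerCard_mul_card hα β (· ≠ 0) fun w hw => hw
  have h2 : (Finset.univ.filter fun x =>
      ψ (-quadVal p m k α β x) * quadSum ψ p m k α β 0 ≠ 0) = Finset.univ :=
    Finset.filter_true_of_mem fun x _ =>
      mul_ne_zero (addChar_apply_ne_zero ψ _) (h.quadSum_ne_zero hα β)
  rw [h2, Finset.card_univ, h.card] at h1
  have h3 := Finset.card_filter_add_card_filter_not (s := Finset.univ)
    (fun γ => quadSum ψ p m k α β γ = 0)
  rw [Finset.card_univ, h.card] at h3
  have h4 : ((Finset.univ.filter fun γ => quadSum ψ p m k α β γ = 0).card : ℂ) +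
      (Finset.univ.filter fun γ => ¬ quadSum ψ p m k α β γ = 0).card = (p : ℂ) ^ n := by
    exact_mod_cast h3
  have h5 : ((Finset.univ.filter fun γ => ¬ quadSum ψ p m k α β γ = 0).card : ℂ) *
      kerCard p m n k α β = (p : ℂ) ^ n := by
    exact_mod_cast h1
  have h6 : (p : ℂ) ^ n / kerCard p m n k α β =
      (Finset.univ.filter fun γ => ¬ quadSum ψ p m k α β γ = 0).card := by
    rw [← h5, mul_div_cancel_right₀ _ hker]
  rw [h.sq_quadSum hα, mul_comm 2 n, pow_mul, sq ((p : ℂ) ^ n), mul_div_mul_left _ _ hpn, h6]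
  linear_combination h4

lemma card_sumSet_zero (h : IsFormSetup p m n k d ψ) :
    ((sumSet ψ p m k 0).card : ℂ) = ∑ ab ∈ pairSet F p m,
      ((p : ℂ) ^ n - (p : ℂ) ^ (2 * n) / quadSum ψ p m k ab.1 ab.2 0 ^ 2) := by
  rw [card_sumSet, Nat.cast_sum]
  exact Finset.sum_congr rfl fun ab hab => h.card_zero (mem_pairSet.1 hab) ab.2

lemma quadSum_eq_zero_or (h : IsFormSetup p m n k d ψ) {α : F} (hα : α ^ p ^ m = α) (β γ : F) :
    quadSum ψ p m k α β γ = 0 ∨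
      ∃ ξ : ℂ, ξ ^ p = 1 ∧ quadSum ψ p m k α β γ = ξ * quadSum ψ p m k α β 0 := by
  refine or_iff_not_imp_left.2 fun h0 => ?_
  obtain ⟨x, rfl⟩ := h.exists_phiMap_eq hα h0
  exact ⟨_, map_pow_p _, h.quadSum_phiMap hα β x⟩

lemma card_sumSet_int (h : IsFormSetup p m n k d ψ) {ξ : ℂ} (hξ : ξ ^ p = 1) {e : ℤ}
    (he : e = if ξ = 1 then (p : ℤ) else 0) {t : ℤ} (ht : t ≠ 0) {c : ℕ}
    (hc : t ^ 2 = (p : ℤ) ^ n * c) :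
    (p : ℤ) * (sumSet ψ p m k (ξ * t)).card * c =
      (formSet ψ p m k t).card * ((p : ℤ) ^ n + t * (e - 1)) := by
  have h1 := h.card_sumSet_mul hξ (t := t) (by exact_mod_cast ht) (c := c) (by exact_mod_cast hc)
  have h2 : (if ξ = 1 then (p : ℂ) else 0) = e := by
    rw [he]
    split_ifs <;> simp
  rw [h2] at h1
  rw [← Int.cast_inj (α := ℂ)]
  push_cast at h1 ⊢
  exact h1

lemma pow_m_eq (h : IsFormSetup p m n k d ψ) : (p : ℤ) ^ m = (p : ℤ) ^ (m - d) * (p : ℤ) ^ d := by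
  rw [← pow_add, Nat.sub_add_cancel h.le_left]

lemma pow_n_eq (h : IsFormSetup p m n k d ψ) :
    (p : ℤ) ^ n = ((p : ℤ) ^ (m - d) * (p : ℤ) ^ d) ^ 2 := by
  rw [h.n_eq, mul_comm 2 m, pow_mul, h.pow_m_eq]

lemma one_lt_pow_d (h : IsFormSetup p m n k d ψ) : (1 : ℤ) < (p : ℤ) ^ d := by
  exact_mod_cast Nat.one_lt_pow h.d_pos.ne' hp.out.one_lt

lemma cast_ne_zero (j : ℕ) : (p : ℤ) ^ j ≠ 0 := pow_ne_zero _ (Nat.cast_ne_zero.2 hp.out.ne_zero)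

lemma cast_pow_sub_one (j : ℕ) : ((p ^ j - 1 : ℕ) : ℤ) = (p : ℤ) ^ j - 1 := by
  rw [Nat.cast_sub (Nat.one_le_pow _ _ hp.out.pos)]
  push_cast
  rfl

lemma formSet_neg_int (h : IsFormSetup p m n k d ψ) :
    ((formSet ψ p m k (-(p : ℂ) ^ (m + d))).card : ℤ) * (((p : ℤ) ^ d) ^ 2 - 1) =
      ((p : ℤ) ^ n - 1) * ((p : ℤ) ^ (m - d) - 1) := by
  have h1 := congrArg (Nat.cast (R := ℤ)) h.card_formSet_neg
  simp only [Nat.cast_mul, cast_pow_sub_one] at h1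
  rwa [mul_comm 2 d, pow_mul] at h1

lemma formSet_half_int (h : IsFormSetup p m n k d ψ) :
    2 * ((formSet ψ p m k ((p : ℂ) ^ (m + d / 2))).card : ℤ) =
      ((p : ℤ) ^ n - 1) * (p : ℤ) ^ (m - d) := by
  have h1 := congrArg (Nat.cast (R := ℤ)) h.card_formSet_half.1
  have h2 : p ^ (m - d) ≤ p ^ m := Nat.pow_le_pow_right hp.out.pos (Nat.sub_le m d)
  simp only [Nat.cast_mul, cast_pow_sub_one, Nat.cast_sub h2, Nat.cast_pow, h.pow_m_eq] at h1
  push_cast at h1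
  have h3 : (p : ℤ) ^ d - 1 ≠ 0 := by linarith [h.one_lt_pow_d]
  apply mul_right_cancel₀ h3
  rw [h1]
  ring

lemma card_pairSet_int (h : IsFormSetup p m n k d ψ) :
    ((formSet ψ p m k ((p : ℂ) ^ m)).card : ℤ) + (formSet ψ p m k (-(p : ℂ) ^ m)).card + 1 +
      (formSet ψ p m k (-(p : ℂ) ^ (m + d))).card +
      2 * (formSet ψ p m k ((p : ℂ) ^ (m + d / 2))).card =
        ((p : ℤ) ^ (m - d) * (p : ℤ) ^ d) ^ 3 := by
  have h1 := congrArg (Nat.cast (R := ℤ)) h.card_pairSet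
  push_cast at h1
  rw [h1, mul_comm 3 m, pow_mul, h.pow_m_eq]

lemma formSet_pos_int (h : IsFormSetup p m n k d ψ) :
    2 * ((p : ℤ) ^ d + 1) * (formSet ψ p m k ((p : ℂ) ^ m)).card =
      (p : ℤ) ^ d * ((p : ℤ) ^ m + 1) * ((p : ℤ) ^ n - 1) := by
  have h1 := h.card_pairSet_int
  have h2 := h.first_moment
  have h3 := h.formSet_half_int
  have h4 := h.formSet_neg_int
  rw [h.pow_m_eq, h.pow_n_eq] at *
  have h5 : (p : ℤ) ^ d - 1 ≠ 0 := by linarith [h.one_lt_pow_d]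
  apply mul_right_cancel₀ h5
  generalize (p : ℤ) ^ d = R at *
  linear_combination (R ^ 2 - 1) * (h1 + h2 - h3) + (R - 1) * h4

lemma formSet_neg_pos_int (h : IsFormSetup p m n k d ψ) :
    2 * ((p : ℤ) ^ d - 1) * (formSet ψ p m k (-(p : ℂ) ^ m)).card =
      (p : ℤ) ^ d * ((p : ℤ) ^ m - 1) * ((p : ℤ) ^ n - 2 * (p : ℤ) ^ (n - d) + 1) := by
  have h1 := h.card_pairSet_int
  have h2 := h.first_moment
  have h3 := h.formSet_half_int
  have h4 := h.formSet_neg_int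
  have h6 : (p : ℤ) ^ (n - d) = ((p : ℤ) ^ (m - d) * (p : ℤ) ^ d) * (p : ℤ) ^ (m - d) := by
    rw [← pow_add, ← pow_add]
    congr 1
    have := h.n_eq
    have := h.le_left
    omega
  rw [h6, h.pow_m_eq, h.pow_n_eq] at *
  have h5 : (p : ℤ) ^ d + 1 ≠ 0 := by linarith [h.one_lt_pow_d]
  apply mul_right_cancel₀ h5
  generalize (p : ℤ) ^ d = R at *
  linear_combination (R ^ 2 - 1) * (h1 - h2 - h3) - (R + 1) * h4

lemma sumSet_pos (h : IsFormSetup p m n k d ψ) {ξ : ℂ} (hξ : ξ ^ p = 1) {e : ℤ}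
    (he : e = if ξ = 1 then (p : ℤ) else 0) :
    2 * ((p : ℤ) ^ d + 1) * (sumSet ψ p m k (ξ * (p : ℂ) ^ m)).card =
      (p : ℤ) ^ (m + d - 1) * ((p : ℤ) ^ m + 1) * ((p : ℤ) ^ m + e - 1) * ((p : ℤ) ^ n - 1) := by
  have h1 := h.card_sumSet_int hξ he (t := (p : ℤ) ^ m) (cast_ne_zero m) (c := 1)
    (by rw [h.n_eq]; push_cast; ring)
  push_cast at h1
  have h2 := h.formSet_pos_int
  have h3 : (p : ℤ) * (p : ℤ) ^ (m + d - 1) = (p : ℤ) ^ m * (p : ℤ) ^ d := by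
    rw [← pow_succ', ← pow_add, Nat.sub_add_cancel (by have := h.pos; omega)]
  have h4 : (p : ℤ) ^ n = ((p : ℤ) ^ m) ^ 2 := by rw [h.n_eq, mul_comm 2 m, pow_mul]
  have h5 : (p : ℤ) ≠ 0 := Nat.cast_ne_zero.2 hp.out.ne_zero
  apply mul_left_cancel₀ h5
  rw [h4] at h1 h2 ⊢
  generalize (p : ℤ) ^ d = R at *
  generalize (p : ℤ) ^ m = P at *
  linear_combination 2 * (R + 1) * h1 + (P ^ 2 + P * (e - 1)) * h2
    - (P + 1) * (P + e - 1) * (P ^ 2 - 1) * h3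

lemma sumSet_neg (h : IsFormSetup p m n k d ψ) {ξ : ℂ} (hξ : ξ ^ p = 1) {e : ℤ}
    (he : e = if ξ = 1 then (p : ℤ) else 0) :
    2 * ((p : ℤ) ^ d - 1) * (sumSet ψ p m k (-(ξ * (p : ℂ) ^ m))).card =
      (p : ℤ) ^ (m + d - 1) * ((p : ℤ) ^ m - 1) * ((p : ℤ) ^ m - e + 1) *
        ((p : ℤ) ^ n - 2 * (p : ℤ) ^ (n - d) + 1) := by
  have h1 := h.card_sumSet_int hξ he (t := -(p : ℤ) ^ m) (neg_ne_zero.2 (cast_ne_zero m)) (c := 1)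
    (by rw [h.n_eq]; push_cast; ring)
  push_cast at h1
  rw [mul_neg] at h1
  have h2 := h.formSet_neg_pos_int
  have h3 : (p : ℤ) * (p : ℤ) ^ (m + d - 1) = (p : ℤ) ^ m * (p : ℤ) ^ d := by
    rw [← pow_succ', ← pow_add, Nat.sub_add_cancel (by have := h.pos; omega)]
  have h4 : (p : ℤ) ^ n = ((p : ℤ) ^ m) ^ 2 := by rw [h.n_eq, mul_comm 2 m, pow_mul]
  have h5 : (p : ℤ) ≠ 0 := Nat.cast_ne_zero.2 hp.out.ne_zero
  apply mul_left_cancel₀ h5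
  rw [h4] at h1 h2 ⊢
  generalize (p : ℤ) ^ d = R at *
  generalize (p : ℤ) ^ m = P at *
  generalize (p : ℤ) ^ (n - d) = Q at *
  linear_combination 2 * (R - 1) * h1 + (P ^ 2 - P * (e - 1)) * h2
    - (P - 1) * (P - e + 1) * (P ^ 2 - 2 * Q + 1) * h3

lemma sumSet_half (h : IsFormSetup p m n k d ψ) {ξ : ℂ} (hξ : ξ ^ p = 1) {e : ℤ}
    (he : e = if ξ = 1 then (p : ℤ) else 0) {ε : ℤ} (hε : ε = 1 ∨ ε = -1) :
    2 * ((sumSet ψ p m k (ε * ξ * (p : ℂ) ^ (m + d / 2))).card : ℤ) =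
      (p : ℤ) ^ (n - 3 * d / 2 - 1) * ((p : ℤ) ^ (m - d / 2) + ε * (e - 1)) *
        ((p : ℤ) ^ n - 1) := by
  have hd := h.half_add_half
  have hd0 := h.d_pos
  have hn := h.n_eq
  have hm := h.le_left
  have hε2 : ε ^ 2 = 1 := by rcases hε with rfl | rfl <;> norm_num
  have hε0 : ε ≠ 0 := by rcases hε with rfl | rfl <;> norm_num
  have h1 := h.card_sumSet_int hξ he (t := ε * (p : ℤ) ^ (m + d / 2))
    (mul_ne_zero hε0 (cast_ne_zero _)) (c := p ^ d) (by
      rw [mul_pow, hε2, one_mul, ← pow_mul, Nat.cast_pow, ← pow_add]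
      congr 1
      omega)
  have h2 : (formSet ψ p m k ((ε * (p : ℤ) ^ (m + d / 2) : ℤ) : ℂ)).card =
      (formSet ψ p m k ((p : ℂ) ^ (m + d / 2))).card := by
    rcases hε with rfl | rfl
    · simp
    · simpa using h.card_formSet_half_eq
  have hw : ξ * ((ε * (p : ℤ) ^ (m + d / 2) : ℤ) : ℂ) = ε * ξ * (p : ℂ) ^ (m + d / 2) := by
    push_cast
    ring
  rw [h2, hw] at h1
  push_cast at h1
  have h3 := h.formSet_half_int
  have hr : (p : ℤ) ^ d = ((p : ℤ) ^ (d / 2)) ^ 2 := by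
    rw [← pow_mul]
    congr 1
    omega
  have hP : (p : ℤ) ^ n = ((p : ℤ) ^ (m - d) * ((p : ℤ) ^ (d / 2)) ^ 2) ^ 2 := by
    rw [h.pow_n_eq, hr]
  have hPr : (p : ℤ) ^ (m + d / 2) = (p : ℤ) ^ (m - d) * ((p : ℤ) ^ (d / 2)) ^ 3 := by
    rw [← pow_mul, ← pow_add]
    congr 1
    omega
  have hTr : (p : ℤ) ^ (m - d / 2) = (p : ℤ) ^ (m - d) * (p : ℤ) ^ (d / 2) := by
    rw [← pow_add]
    congr 1
    omega
  have h4 : (p : ℤ) * (p : ℤ) ^ (n - 3 * d / 2 - 1) =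
      ((p : ℤ) ^ (m - d)) ^ 2 * (p : ℤ) ^ (d / 2) := by
    rw [← pow_succ', ← pow_mul, ← pow_add]
    congr 1
    omega
  have h5 : (p : ℤ) * ((p : ℤ) ^ (d / 2)) ^ 2 ≠ 0 :=
    mul_ne_zero (Nat.cast_ne_zero.2 hp.out.ne_zero) (pow_ne_zero _ (cast_ne_zero _))
  apply mul_left_cancel₀ h5
  rw [hP, hr, hPr] at h1
  rw [hP] at h3
  rw [hP, hTr]
  generalize (p : ℤ) ^ (d / 2) = r at *
  generalize (p : ℤ) ^ (m - d) = T at *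
  linear_combination 2 * h1 + ((T * r ^ 2) ^ 2 + ε * (T * r ^ 3) * (e - 1)) * h3
    - r ^ 2 * (T * r + ε * (e - 1)) * ((T * r ^ 2) ^ 2 - 1) * h4

lemma sumSet_full_neg (h : IsFormSetup p m n k d ψ) {ξ : ℂ} (hξ : ξ ^ p = 1) {e : ℤ}
    (he : e = if ξ = 1 then (p : ℤ) else 0) :
    ((p : ℤ) ^ (2 * d) - 1) * (sumSet ψ p m k (-(ξ * (p : ℂ) ^ (m + d)))).card =
      (p : ℤ) ^ (m - d - 1) * ((p : ℤ) ^ (m - d) - 1) * ((p : ℤ) ^ n - 1) *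
        ((p : ℤ) ^ (m - d) - e + 1) := by
  have h1 := h.card_sumSet_int hξ he (t := -(p : ℤ) ^ (m + d))
    (neg_ne_zero.2 (cast_ne_zero _)) (c := p ^ (2 * d)) (by rw [h.n_eq]; push_cast; ring)
  push_cast at h1
  rw [mul_neg] at h1
  have h2 := h.formSet_neg_int
  have h3 : (p : ℤ) * ((p : ℤ) ^ (m - d - 1) * ((p : ℤ) ^ (m - d) - 1)) =
      (p : ℤ) ^ (m - d) * ((p : ℤ) ^ (m - d) - 1) := by
    rcases Nat.eq_zero_or_pos (m - d) with h0 | h0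
    · simp [h0]
    · rw [← mul_assoc, ← pow_succ', Nat.sub_add_cancel h0]
  have hR : (p : ℤ) ^ (2 * d) = ((p : ℤ) ^ d) ^ 2 := by rw [mul_comm 2 d, pow_mul]
  have h5 : (p : ℤ) * ((p : ℤ) ^ d) ^ 2 ≠ 0 :=
    mul_ne_zero (Nat.cast_ne_zero.2 hp.out.ne_zero) (pow_ne_zero _ (cast_ne_zero _))
  apply mul_left_cancel₀ h5
  have hmd : (p : ℤ) ^ (m + d) = (p : ℤ) ^ (m - d) * (p : ℤ) ^ d * (p : ℤ) ^ d := by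
    rw [pow_add, h.pow_m_eq]
  rw [hR, h.pow_n_eq, hmd] at h1
  rw [h.pow_n_eq] at h2
  rw [hR, h.pow_n_eq]
  generalize (p : ℤ) ^ d = R at *
  generalize (p : ℤ) ^ (m - d) = T at *
  linear_combination (R ^ 2 - 1) * h1 + ((T * R) ^ 2 - T * R * R * (e - 1)) * h2
    - R ^ 2 * ((T * R) ^ 2 - 1) * (T - e + 1) * h3

lemma sumSet_full (h : IsFormSetup p m n k d ψ) :
    (sumSet ψ p m k ((p : ℂ) ^ n)).card = 1 := by
  have h1 := h.card_sumSet_int (one_pow p) (if_pos rfl).symm (t := (p : ℤ) ^ n)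
    (cast_ne_zero n) (c := p ^ n) (by push_cast; ring)
  push_cast at h1
  rw [one_mul, h.card_formSet_full] at h1
  have h5 : (p : ℤ) * (p : ℤ) ^ n ≠ 0 :=
    mul_ne_zero (Nat.cast_ne_zero.2 hp.out.ne_zero) (cast_ne_zero _)
  rw [← Nat.cast_inj (R := ℤ)]
  apply mul_left_cancel₀ h5
  push_cast
  linear_combination h1

lemma sumSet_zero (h : IsFormSetup p m n k d ψ) :
    ((sumSet ψ p m k 0).card : ℤ) = ((p : ℤ) ^ n - 1) *
      ((p : ℤ) ^ (3 * m - d) - (p : ℤ) ^ (3 * m - 2 * d) + (p : ℤ) ^ (3 * m - 3 * d)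
        - (p : ℤ) ^ (n - 2 * d) + 1) := by
  have hd := h.half_add_half
  have hn := h.n_eq
  have hm := h.le_left
  have hp0 : ∀ j, (p : ℂ) ^ j ≠ 0 := fun j => pow_ne_zero _ (Nat.cast_ne_zero.2 hp.out.ne_zero)
  have h1 := h.card_sumSet_zero
  rw [h.sum_pairSet fun t => (p : ℂ) ^ n - (p : ℂ) ^ (2 * n) / t ^ 2] at h1
  have hdiv : ∀ i j : ℕ, i + 2 * j = 2 * n → (p : ℂ) ^ (2 * n) / ((p : ℂ) ^ j) ^ 2 = (p : ℂ) ^ i := by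
    intro i j hij
    rw [← pow_mul, ← hij, mul_comm j 2, pow_add, mul_div_cancel_right₀ _ (hp0 _)]
  simp only [neg_sq, hdiv n m (by omega), hdiv 0 n (by omega),
    hdiv (2 * (m - d)) (m + d) (by omega), hdiv ((m - d) + m) (m + d / 2) (by omega),
    h.card_formSet_half_eq, sub_self, mul_zero, zero_add, pow_zero] at h1
  have h2 : ((sumSet ψ p m k 0).card : ℤ) = (p : ℤ) ^ n - 1 +
      (formSet ψ p m k (-(p : ℂ) ^ (m + d))).card * ((p : ℤ) ^ n - (p : ℤ) ^ (2 * (m - d))) +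
      2 * (formSet ψ p m k ((p : ℂ) ^ (m + d / 2))).card *
        ((p : ℤ) ^ n - (p : ℤ) ^ (m - d + m)) := by
    rw [← Int.cast_inj (α := ℂ)]
    push_cast
    rw [h1]
    ring
  have e1 : (p : ℤ) ^ (3 * m - d) =
      (p : ℤ) ^ (m - d) * ((p : ℤ) ^ (m - d) * (p : ℤ) ^ d) ^ 2 := by
    rw [← h.pow_m_eq, ← pow_mul, ← pow_add]
    congr 1
    omega
  have e2 : (p : ℤ) ^ (3 * m - 2 * d) =
      ((p : ℤ) ^ (m - d)) ^ 2 * ((p : ℤ) ^ (m - d) * (p : ℤ) ^ d) := by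
    rw [← h.pow_m_eq, ← pow_mul, ← pow_add]
    congr 1
    omega
  have e3 : (p : ℤ) ^ (3 * m - 3 * d) = ((p : ℤ) ^ (m - d)) ^ 3 := by
    rw [← pow_mul]
    congr 1
    omega
  have e4 : (p : ℤ) ^ (n - 2 * d) = ((p : ℤ) ^ (m - d)) ^ 2 := by
    rw [← pow_mul]
    congr 1
    omega
  have e5 : (p : ℤ) ^ (2 * (m - d)) = ((p : ℤ) ^ (m - d)) ^ 2 := by
    rw [← pow_mul, mul_comm]
  have h3 := h.formSet_half_int
  have h4 := h.formSet_neg_int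
  have e6 : (p : ℤ) ^ (m - d + m) =
      (p : ℤ) ^ (m - d) * ((p : ℤ) ^ (m - d) * (p : ℤ) ^ d) := by
    rw [pow_add, h.pow_m_eq]
  rw [e5, e6, h.pow_n_eq] at h2
  rw [h.pow_n_eq] at h3 h4
  rw [h2, e1, e2, e3, e4, h.pow_n_eq]
  generalize (p : ℤ) ^ d = R at *
  generalize (p : ℤ) ^ (m - d) = T at *
  linear_combination T ^ 2 * h4 + ((T * R) ^ 2 - T * (T * R)) * h3

end IsFormSetup

/-- The canonical additive character `x ↦ ζ_p^{Tr x}` of a finite field of characteristic `p`. -/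
def traceChar (p : ℕ) [NeZero p] (F : Type) [Field F] [Algebra (ZMod p) F] : AddChar F ℂ :=
  (ZMod.stdAddChar (N := p)).compAddMonoidHom (Algebra.trace (ZMod p) F).toAddMonoidHom

lemma expChar_eq (p : ℕ) [NeZero p] (c : ZMod p) : expChar p c = ZMod.stdAddChar c := by
  have h := ZMod.stdAddChar_coe (N := p) (c.val : ℤ)
  rw [Int.cast_natCast, ZMod.natCast_zmod_val] at h
  rw [h, expChar]
  push_cast
  rfl

section Bridge

variable {p m n k d : ℕ} [hp : Fact p.Prime] {F : Type} [Field F] [Fintype F] [Algebra (ZMod p) F]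

lemma fToZMod_algebraMap (c : ZMod p) : fToZMod p (algebraMap (ZMod p) F c) = c :=
  Function.leftInverse_invFun (algebraMap (ZMod p) F).injective c

lemma finrank_eq_of_card (hF : Fintype.card F = p ^ n) : Module.finrank (ZMod p) F = n := by
  have h := Module.card_eq_pow_finrank (K := ZMod p) (V := F)
  rw [hF, ZMod.card] at h
  exact (Nat.pow_right_injective hp.out.two_le h).symm

lemma trSum_eq_algebraMap (hF : Fintype.card F = p ^ n) (y : F) :
    trSum p 1 n y = algebraMap (ZMod p) F (Algebra.trace (ZMod p) F y) := by
  rw [FiniteField.algebraMap_trace_eq_sum_pow, finrank_eq_of_card hF, trSum, Nat.card_zmod]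
  simp

lemma trSum_half (hodd : p % 2 = 1) (hn : n = 2 * m) [CharP F p] {y : F} (hy : y ^ p ^ m = y) :
    trSum p 1 m y = trSum p 1 n (y / 2) := by
  have h2 : (2 : F) ≠ 0 := by
    intro h
    have h1 : ((2 : ℕ) : F) = 0 := by exact_mod_cast h
    have := (Nat.prime_dvd_prime_iff_eq hp.out Nat.prime_two).1 ((CharP.cast_eq_zero_iff F p 2).1 h1)
    omega
  have htwo : ∀ j : ℕ, (2 : F) ^ p ^ j = 2 := fun j => by
    have := map_ofNat (iterateFrobenius F p j) 2
    rwa [iterateFrobenius_def] at this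
  simp only [trSum, one_mul, hn, two_mul, Finset.sum_range_add, div_pow, htwo, pow_add, pow_mul, hy]
  rw [← Finset.sum_add_distrib]
  exact Finset.sum_congr rfl fun i _ => by field_simp; ring

lemma traceChar_ne_one : traceChar p F ≠ 1 := by
  intro h
  obtain ⟨x, hx⟩ := Algebra.trace_surjective (ZMod p) F 1
  have h1 : traceChar p F x = 1 := by rw [h]; rfl
  have h2 : ZMod.stdAddChar (N := p) 1 = ZMod.stdAddChar (N := p) 0 := by
    rw [AddChar.map_zero_eq_one, ← h1, ← hx]
    rfl
  exact one_ne_zero (ZMod.injective_stdAddChar h2)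

lemma traceChar_frob [CharP F p] (x : F) : traceChar p F (x ^ p) = traceChar p F x := by
  have h : Algebra.trace (ZMod p) F (x ^ p) = Algebra.trace (ZMod p) F x := by
    have h1 := Algebra.trace_eq_of_algEquiv (FiniteField.frobeniusAlgEquivOfAlgebraic (ZMod p) F) x
    simpa [ZMod.card] using h1
  exact congrArg (ZMod.stdAddChar (N := p)) h

lemma isFormSetup_traceChar [CharP F p] (hodd : p % 2 = 1) (hm : 0 < m) (hn : n = 2 * m)
    (hk : k ≤ n - 1) (hd : d = m.gcd k) (hd' : d = (m + k).gcd (2 * k)) (hdeven : d % 2 = 0)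
    (hF : Fintype.card F = p ^ n) : IsFormSetup p m n k d (traceChar p F) where
  odd := hodd
  pos := hm
  n_eq := hn
  le := by omega
  gcd_left := hd.symm
  gcd_add := by
    rw [hd', hn, Nat.gcd_comm]
    apply Nat.dvd_antisymm
    · refine Nat.dvd_gcd (Nat.gcd_dvd_left _ _) ?_
      have h1 := ((Nat.gcd_dvd_left (m + k) (2 * m)).mul_left 2)
      rw [mul_add] at h1
      exact (Nat.dvd_add_right (Nat.gcd_dvd_right _ _)).1 h1
    · refine Nat.dvd_gcd (Nat.gcd_dvd_left _ _) ?_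
      have h1 := ((Nat.gcd_dvd_left (m + k) (2 * k)).mul_left 2)
      rw [mul_add] at h1
      exact (Nat.dvd_add_left (Nat.gcd_dvd_right _ _)).1 h1
  even := hdeven
  card := hF
  ne_one := traceChar_ne_one
  frob := traceChar_frob

lemma Ssum_eq_quadSum [CharP F p] (h : IsFormSetup p m n k d (traceChar p F)) {α : F}
    (hα : α ^ p ^ m = α) (β γ : F) :
    Ssum p m n k F α β γ = quadSum (traceChar p F) p m k α β γ := by
  refine Finset.sum_congr rfl fun x _ => ?_
  have hy : (α * x ^ (p ^ m + 1)) ^ p ^ m = α * x ^ (p ^ m + 1) := by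
    rw [mul_pow, hα, h.norm_fixed]
  rw [trSum_half h.odd h.n_eq hy, trSum_eq_algebraMap h.card, trSum_eq_algebraMap h.card,
    fToZMod_algebraMap, fToZMod_algebraMap, ← map_add, expChar_eq, quadVal, add_assoc]
  rfl

lemma Scount_eq_card [CharP F p] (h : IsFormSetup p m n k d (traceChar p F)) (v : ℂ) :
    Scount p m n k F v = (IsFormSetup.sumSet (traceChar p F) p m k v).card := by
  rw [Scount, Nat.card_eq_fintype_card, Fintype.card_subtype, IsFormSetup.sumSet]
  congr 1
  refine Finset.filter_congr fun x _ => and_congr_right fun hx => ?_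
  rw [Ssum_eq_quadSum h hx]

lemma isPrimitiveRoot_zetaC : IsPrimitiveRoot (zetaC p) p :=
  Complex.isPrimitiveRoot_exp p hp.out.ne_zero

end Bridge

namespace IsFormSetup

variable {F : Type} [Field F] [Fintype F] {p m n k d : ℕ} [hp : Fact p.Prime] [CharP F p]
  {ψ : AddChar F ℂ}

lemma eq_one_of_quadSum_eq (h : IsFormSetup p m n k d ψ) {α β γ : F} (hα : α ^ p ^ m = α) {ξ : ℂ}
    (hξ : ξ ^ p = 1) (hS : quadSum ψ p m k α β γ = ξ * (p : ℂ) ^ n) : ξ = 1 := by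
  by_contra hne
  have h1 := h.card_sumSet_int hξ (e := 0) (by simp [hne]) (t := (p : ℤ) ^ n)
    (cast_ne_zero n) (c := p ^ n) (by push_cast; ring)
  push_cast at h1
  have h2 : (sumSet ψ p m k (ξ * (p : ℂ) ^ n)).card = 0 := by
    simpa [hp.out.ne_zero] using h1
  rw [Finset.card_eq_zero] at h2
  have h3 : (α, β, γ) ∈ sumSet ψ p m k (ξ * (p : ℂ) ^ n) := by
    simp [sumSet, hα, hS]
  simp [h2] at h3

/-- The values of the sums with linear term. -/
lemma quadSum_values (h : IsFormSetup p m n k d ψ) {α : F} (hα : α ^ p ^ m = α) (β γ : F) :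
    quadSum ψ p m k α β γ = 0 ∨ quadSum ψ p m k α β γ = (p : ℂ) ^ n ∨
      ∃ ξ : ℂ, ξ ^ p = 1 ∧ (quadSum ψ p m k α β γ = ξ * (p : ℂ) ^ m ∨
        quadSum ψ p m k α β γ = -(ξ * (p : ℂ) ^ m) ∨
        quadSum ψ p m k α β γ = -(ξ * (p : ℂ) ^ (m + d)) ∨
        ∃ ε : ℤ, (ε = 1 ∨ ε = -1) ∧
          quadSum ψ p m k α β γ = (ε : ℂ) * ξ * (p : ℂ) ^ (m + d / 2)) := by
  rcases h.quadSum_eq_zero_or hα β γ with h0 | ⟨ξ, hξ, hS⟩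
  · exact Or.inl h0
  rcases h.quadSum_eq hα β with hT | hT | hT | hT | hT | hT <;> rw [hT] at hS
  · exact Or.inr (Or.inr ⟨ξ, hξ, Or.inl hS⟩)
  · exact Or.inr (Or.inr ⟨ξ, hξ, Or.inr (Or.inl (by rw [hS, mul_neg]))⟩)
  · rw [h.eq_one_of_quadSum_eq hα hξ hS, one_mul] at hS
    exact Or.inr (Or.inl hS)
  · exact Or.inr (Or.inr ⟨ξ, hξ, Or.inr (Or.inr (Or.inl (by rw [hS, mul_neg])))⟩)
  · exact Or.inr (Or.inr ⟨ξ, hξ, Or.inr (Or.inr (Or.inr ⟨1, Or.inl rfl, by rw [hS]; simp⟩))⟩)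
  · exact Or.inr (Or.inr ⟨ξ, hξ, Or.inr (Or.inr (Or.inr ⟨-1, Or.inr rfl, by rw [hS]; simp⟩))⟩)

end IsFormSetup

theorem stmt15 (p m k n d d' : ℕ) (hp : Nat.Prime p) (hodd : p % 2 = 1)
    (hm : 0 < m) (hn : n = 2 * m) (hk : k ≤ n - 1) (hkm : k ≠ m)
    (hd : d = Nat.gcd m k) (hd' : d' = Nat.gcd (m + k) (2 * k))
    (F : Type) [Field F] [Fintype F] [Algebra (ZMod p) F] (hF : Fintype.card F = p ^ n) (hcase : d' = d) (hdeven : d % 2 = 0) :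
    (2 * ((p : ℤ) ^ d + 1) * (Scount p m n k F ((p : ℂ) ^ m) : ℤ)
        = (p : ℤ) ^ (m + d - 1) * ((p : ℤ) ^ m + 1) * ((p : ℤ) ^ m + (p : ℤ) - 1)
          * ((p : ℤ) ^ n - 1)) ∧
    (2 * ((p : ℤ) ^ d - 1) * (Scount p m n k F (-(p : ℂ) ^ m) : ℤ)
        = (p : ℤ) ^ (m + d - 1) * ((p : ℤ) ^ m - 1) * ((p : ℤ) ^ m - (p : ℤ) + 1)
          * ((p : ℤ) ^ n - 2 * (p : ℤ) ^ (n - d) + 1)) ∧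
    (∀ j : ℕ, 1 ≤ j → j ≤ p - 1 →
      2 * ((p : ℤ) ^ d + 1) * (Scount p m n k F (zetaC p ^ j * (p : ℂ) ^ m) : ℤ)
        = (p : ℤ) ^ (m + d - 1) * ((p : ℤ) ^ n - 1) ^ 2) ∧
    (∀ j : ℕ, 1 ≤ j → j ≤ p - 1 →
      2 * ((p : ℤ) ^ d - 1) * (Scount p m n k F (-(zetaC p ^ j * (p : ℂ) ^ m)) : ℤ)
        = (p : ℤ) ^ (m + d - 1) * ((p : ℤ) ^ n - 1)
          * ((p : ℤ) ^ n - 2 * (p : ℤ) ^ (n - d) + 1)) ∧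
    (∀ ε : ℤ, ε = 1 ∨ ε = -1 →
      2 * (Scount p m n k F ((ε : ℂ) * (p : ℂ) ^ (m + d / 2)) : ℤ)
        = (p : ℤ) ^ (n - 3 * d / 2 - 1) * ((p : ℤ) ^ (m - d / 2) + ε * ((p : ℤ) - 1))
          * ((p : ℤ) ^ n - 1)) ∧
    (∀ ε : ℤ, ε = 1 ∨ ε = -1 → ∀ j : ℕ, 1 ≤ j → j ≤ p - 1 →
      2 * (Scount p m n k F ((ε : ℂ) * zetaC p ^ j * (p : ℂ) ^ (m + d / 2)) : ℤ)
        = (p : ℤ) ^ (n - 3 * d / 2 - 1) * ((p : ℤ) ^ (m - d / 2) - ε)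
          * ((p : ℤ) ^ n - 1)) ∧
    (((p : ℤ) ^ (2 * d) - 1) * (Scount p m n k F (-(p : ℂ) ^ (m + d)) : ℤ)
        = (p : ℤ) ^ (m - d - 1) * ((p : ℤ) ^ (m - d) - 1) * ((p : ℤ) ^ n - 1)
          * ((p : ℤ) ^ (m - d) - (p : ℤ) + 1)) ∧
    (∀ j : ℕ, 1 ≤ j → j ≤ p - 1 →
      ((p : ℤ) ^ (2 * d) - 1) * (Scount p m n k F (-(zetaC p ^ j * (p : ℂ) ^ (m + d))) : ℤ)
        = (p : ℤ) ^ (m - d - 1) * ((p : ℤ) ^ (m - d) - 1) * ((p : ℤ) ^ n - 1)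
          * ((p : ℤ) ^ (m - d) + 1)) ∧
    ((Scount p m n k F 0 : ℤ)
        = ((p : ℤ) ^ n - 1) * ((p : ℤ) ^ (3 * m - d) - (p : ℤ) ^ (3 * m - 2 * d)
            + (p : ℤ) ^ (3 * m - 3 * d) - (p : ℤ) ^ (n - 2 * d) + 1)) ∧
    (Scount p m n k F ((p : ℂ) ^ n) = 1) ∧
    (∀ α β γ : F, α ^ p ^ m = α →
      Ssum p m n k F α β γ = (p : ℂ) ^ m ∨
      Ssum p m n k F α β γ = -(p : ℂ) ^ m ∨
      (∃ j : ℕ, 1 ≤ j ∧ j ≤ p - 1 ∧ Ssum p m n k F α β γ = zetaC p ^ j * (p : ℂ) ^ m) ∨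
      (∃ j : ℕ, 1 ≤ j ∧ j ≤ p - 1 ∧ Ssum p m n k F α β γ = -(zetaC p ^ j * (p : ℂ) ^ m)) ∨
      (∃ ε : ℤ, (ε = 1 ∨ ε = -1) ∧
        Ssum p m n k F α β γ = (ε : ℂ) * (p : ℂ) ^ (m + d / 2)) ∨
      (∃ ε : ℤ, (ε = 1 ∨ ε = -1) ∧ ∃ j : ℕ, 1 ≤ j ∧ j ≤ p - 1 ∧
        Ssum p m n k F α β γ = (ε : ℂ) * zetaC p ^ j * (p : ℂ) ^ (m + d / 2)) ∨
      Ssum p m n k F α β γ = -(p : ℂ) ^ (m + d) ∨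
      (∃ j : ℕ, 1 ≤ j ∧ j ≤ p - 1 ∧ Ssum p m n k F α β γ = -(zetaC p ^ j * (p : ℂ) ^ (m + d))) ∨
      Ssum p m n k F α β γ = 0 ∨
      Ssum p m n k F α β γ = (p : ℂ) ^ n) := by
  have : Fact p.Prime := ⟨hp⟩
  have : CharP F p := charP_of_injective_algebraMap (algebraMap (ZMod p) F).injective p
  have h : IsFormSetup p m n k d (traceChar p F) :=
    isFormSetup_traceChar hodd hm hn hk hd (hcase.symm.trans hd') hdeven hF
  have hz : IsPrimitiveRoot (zetaC p) p := isPrimitiveRoot_zetaC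
  have hzp : ∀ j, (zetaC p ^ j) ^ p = 1 := fun j => by rw [pow_right_comm, hz.pow_eq_one, one_pow]
  have he : ∀ j, 1 ≤ j → j ≤ p - 1 → (0 : ℤ) = if zetaC p ^ j = 1 then (p : ℤ) else 0 :=
    fun j h1 h2 => (if_neg (hz.pow_ne_one_of_pos_of_lt (by omega) (by omega))).symm
  have he1 : (p : ℤ) = if (1 : ℂ) = 1 then (p : ℤ) else 0 := (if_pos rfl).symm
  have hpn : (p : ℤ) ^ n = ((p : ℤ) ^ m) ^ 2 := by rw [hn, mul_comm, pow_mul]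
  simp only [Scount_eq_card h]
  refine ⟨?_, ?_, fun j hj hj' => ?_, fun j hj hj' => ?_, fun ε hε => ?_,
    fun ε hε j hj hj' => ?_, ?_, fun j hj hj' => ?_, h.sumSet_zero, h.sumSet_full,
    fun α β γ hα => ?_⟩
  · simpa only [one_mul] using h.sumSet_pos (one_pow p) he1
  · simpa only [one_mul] using h.sumSet_neg (one_pow p) he1
  · rw [h.sumSet_pos (hzp j) (he j hj hj'), hpn]
    ring
  · rw [h.sumSet_neg (hzp j) (he j hj hj'), hpn]
    ring
  · simpa only [mul_one] using h.sumSet_half (one_pow p) he1 hε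
  · rw [h.sumSet_half (hzp j) (he j hj hj') hε]
    ring
  · simpa only [one_mul] using h.sumSet_full_neg (one_pow p) he1
  · rw [h.sumSet_full_neg (hzp j) (he j hj hj')]
    ring
  · rw [Ssum_eq_quadSum h hα]
    rcases h.quadSum_values hα β γ with hS | hS | ⟨ξ, hξ, hS⟩
    · tauto
    · tauto
    obtain ⟨j, hj, rfl⟩ := hz.eq_pow_of_pow_eq_one hξ
    rcases Nat.eq_zero_or_pos j with rfl | hj0
    · simp only [pow_zero, one_mul, mul_one] at hS
      rcases hS with hS | hS | hS | hS
      · exact Or.inl hS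
      · exact Or.inr (Or.inl hS)
      · exact Or.inr (Or.inr (Or.inr (Or.inr (Or.inr (Or.inr (Or.inl hS))))))
      · exact Or.inr (Or.inr (Or.inr (Or.inr (Or.inl hS))))
    · have hj' : j ≤ p - 1 := by omega
      rcases hS with hS | hS | hS | ⟨ε, hε, hS⟩
      · exact Or.inr (Or.inr (Or.inl ⟨j, hj0, hj', hS⟩))
      · exact Or.inr (Or.inr (Or.inr (Or.inl ⟨j, hj0, hj', hS⟩)))
      · exact Or.inr (Or.inr (Or.inr (Or.inr (Or.inr (Or.inr (Or.inr
          (Or.inl ⟨j, hj0, hj', hS⟩)))))))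
      · exact Or.inr (Or.inr (Or.inr (Or.inr (Or.inr (Or.inl ⟨ε, hε, j, hj0, hj', hS⟩)))))
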